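/- arXiv:1901.06915 — 3 statements merged into one kernel-verified Lean document; each statement's English description precedes it below -/
import Mathlib

section
/- Let m,b ≥ 1 and n ≥ b+1 be integers and let C0(m,b) = (m+1)! · Σ_{i=0}^{2b(m-1)} C(m·b(m-1), i). For every power of two q with q ≥ C0(m,b) · n^{2b(m-1)} + n^{b-1}, there exists a maximally recoverable code C that instantiates the grid-like topology T_{m×n}(1,b,0) over the field F_q. -/
/-- A set of `m × n` matrices over `F` is a code instantiating the grid-like topology
`T_{m×n}(a,b,0)`: it is the tensor product code of a column code cut out by `a`
parity-check equations and a row code cut out by `b` parity-check equations. -/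
def IsTensorTopologyCode (F : Type) [Field F] (m n a b : ℕ)
    (C : Set (Matrix (Fin m) (Fin n) F)) : Prop :=
  ∃ (Hcol : Matrix (Fin a) (Fin m) F) (Hrow : Matrix (Fin b) (Fin n) F),
    C = {c | (∀ j, Hcol.mulVec (fun i => c i j) = 0) ∧ ∀ i, Hrow.mulVec (c i) = 0}

/-- A code `C` corrects the erasure pattern `E` if every codeword is uniquely
determined by its entries outside `E`. -/
def CorrectsPattern {F : Type} [Field F] {m n : ℕ} (C : Set (Matrix (Fin m) (Fin n) F))
    (E : Finset (Fin m × Fin n)) : Prop :=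
  ∀ c₁ ∈ C, ∀ c₂ ∈ C, (∀ p : Fin m × Fin n, p ∉ E → c₁ p.1 p.2 = c₂ p.1 p.2) → c₁ = c₂

/-- An erasure pattern `E` is correctable for the topology `T_{m×n}(a,b,0)` if over some
finite field there is a code instantiating the topology which corrects `E`. -/
def CorrectableForTopology (m n a b : ℕ) (E : Finset (Fin m × Fin n)) : Prop :=
  ∃ (F : Type) (_fi : Field F) (_ft : Fintype F),
    haveI := _fi
    ∃ C : Set (Matrix (Fin m) (Fin n) F), IsTensorTopologyCode F m n a b C ∧ CorrectsPattern C E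

/-- A code is maximally recoverable for `T_{m×n}(a,b,0)` if it instantiates the topology
and corrects every erasure pattern that is correctable for the topology. -/
def IsMaximallyRecoverable (F : Type) [Field F] (m n a b : ℕ)
    (C : Set (Matrix (Fin m) (Fin n) F)) : Prop :=
  IsTensorTopologyCode F m n a b C ∧
    ∀ E : Finset (Fin m × Fin n), CorrectableForTopology m n a b E → CorrectsPattern C E

open Finset

/-- The columns erased in row `i`. -/
def mrRow {m n : ℕ} (E : Finset (Fin m × Fin n)) (i : Fin m) : Finset (Fin n) :=
  Finset.univ.filter (fun j => (i, j) ∈ E)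

/-- The regularity condition. -/
def MrRegular {m n : ℕ} (b : ℕ) (A : Fin m → Finset (Fin n)) : Prop :=
  ∀ I : Finset (Fin m), I.Nonempty → ∑ i ∈ I, (A i).card + b ≤ (I.biUnion A).card + b * I.card

/-- Extension by zero as a linear map. -/
noncomputable def mrExt {F : Type} [Field F] {m n : ℕ} (D : Finset (Fin m × Fin n)) :
    (D → F) →ₗ[F] (Fin m → Fin n → F) where
  toFun c := fun i j => if h : (i, j) ∈ D then c ⟨(i, j), h⟩ else 0
  map_add' x y := by
    ext i j
    by_cases h : (i, j) ∈ D <;> simp [h]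
  map_smul' x y := by
    ext i j
    by_cases h : (i, j) ∈ D <;> simp [h]

theorem mr_regular_of_corrects {F : Type} [Field F] {m n b : ℕ}
    (C : Set (Matrix (Fin m) (Fin n) F)) (hC : IsTensorTopologyCode F m n 1 b C)
    (E : Finset (Fin m × Fin n)) (hE : CorrectsPattern C E) : MrRegular b (mrRow E) := by
  classical
  obtain ⟨Hc, H, rfl⟩ := hC
  intro I hI
  obtain ⟨g, i0, hi0, hg0, hg⟩ : ∃ (g : Fin m → F) (i0 : Fin m), i0 ∈ I ∧ g i0 ≠ 0 ∧
      ∀ x : Fin m → F, (∀ i, i ∉ I → x i = 0) → ∑ i, g i * x i = 0 → ∑ i, Hc 0 i * x i = 0 := by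
    by_cases h : ∃ i ∈ I, Hc 0 i ≠ 0
    · obtain ⟨i0, h1, h2⟩ := h
      exact ⟨Hc 0, i0, h1, h2, fun x _ h => h⟩
    · push Not at h
      obtain ⟨i0, h1⟩ := hI
      refine ⟨Pi.single i0 1, i0, h1, by simp, fun x hx _ => ?_⟩
      apply Finset.sum_eq_zero
      intro i _
      by_cases hi : i ∈ I
      · simp [h i hi]
      · simp [hx i hi]
  set D : Finset (Fin m × Fin n) := E.filter (fun p => p.1 ∈ I) with hD
  set V : Finset (Fin n) := I.biUnion (mrRow E) with hV
  let Φ : (D → F) →ₗ[F] ((V → F) × ({x // x ∈ I.erase i0} → Fin b → F)) :=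
    LinearMap.prod
      (LinearMap.pi fun j : V => ∑ i, g i • ((LinearMap.proj (j : Fin n)).comp
        ((LinearMap.proj i).comp (mrExt D))))
      (LinearMap.pi fun i => (H.mulVecLin).comp ((LinearMap.proj (i : Fin m)).comp (mrExt D)))
  have hinj : Function.Injective Φ := by
    rw [← LinearMap.ker_eq_bot, LinearMap.ker_eq_bot']
    intro c hc
    have h1 : ∀ j ∈ V, ∑ i, g i * mrExt D c i j = 0 := by
      intro j hj
      have := congrFun (congrArg Prod.fst hc) ⟨j, hj⟩
      simpa [Φ] using this
    have h2 : ∀ i ∈ I, i ≠ i0 → H.mulVec (mrExt D c i) = 0 := by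
      intro i hi hne
      have := congrFun (congrArg Prod.snd hc) ⟨i, by simp [hi, hne]⟩
      simpa [Φ] using this
    have hz : ∀ i j, (i, j) ∉ D → mrExt D c i j = 0 := by
      intro i j h
      simp [mrExt, h]
    have hI0 : ∀ i, i ∉ I → mrExt D c i = 0 := by
      intro i hi
      ext j
      exact hz i j (by simp [hD, hi])
    have h1' : ∀ j, ∑ i, g i * mrExt D c i j = 0 := by
      intro j
      by_cases hj : j ∈ V
      · exact h1 j hj
      · apply Finset.sum_eq_zero
        intro i _
        rw [hz i j, mul_zero]
        intro h
        apply hj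
        simp only [hD, Finset.mem_filter] at h
        simp only [hV, Finset.mem_biUnion]
        exact ⟨i, h.2, by simp [mrRow, h.1]⟩
    have h3 : H.mulVec (mrExt D c i0) = 0 := by
      have e1 : ∑ i, g i • mrExt D c i = 0 := by
        ext j
        simpa using h1' j
      have e2 : ∑ i, g i • H.mulVec (mrExt D c i) = 0 := by
        have := congrArg H.mulVecLin e1
        simpa using this
      rw [Finset.sum_eq_single i0] at e2
      · exact (smul_eq_zero.mp e2).resolve_left hg0
      · intro i _ hne
        by_cases hi : i ∈ I
        · rw [h2 i hi hne, smul_zero]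
        · rw [hI0 i hi]; simp
      · simp
    have h4 : (mrExt D c : Matrix (Fin m) (Fin n) F) = 0 := by
      apply hE
      · refine ⟨fun j => ?_, fun i => ?_⟩
        · ext k
          have := hg (fun i => mrExt D c i j) (fun i hi => by simp [hI0 i hi]) (h1' j)
          rw [Subsingleton.elim k 0]
          simpa [Matrix.mulVec, dotProduct] using this
        · by_cases hi : i ∈ I
          · by_cases hne : i = i0
            · rw [hne]; exact h3
            · exact h2 i hi hne
          · rw [hI0 i hi]; simp
      · refine ⟨fun j => ?_, fun i => ?_⟩
        · exact Matrix.mulVec_zero _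
        · exact Matrix.mulVec_zero _
      · intro p hp
        exact hz p.1 p.2 (by simp [hD, hp])
    ext ⟨⟨i, j⟩, hp⟩
    have := congrFun (congrFun h4 i) j
    simpa [mrExt, hp] using this
  have hle := LinearMap.finrank_le_finrank_of_injective hinj
  have hcard : D.card = ∑ i ∈ I, (mrRow E i).card := by
    rw [Finset.card_eq_sum_card_fiberwise (f := Prod.fst) (t := I)]
    · apply Finset.sum_congr rfl
      intro i hi
      symm
      apply Finset.card_bij (fun j _ => (i, j))
      · intro j hj
        simp [mrRow] at hj
        simp [hD, hj, hi]
      · intro a _ b _ h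
        simpa using h
      · rintro ⟨a, j⟩ h
        simp [hD] at h
        obtain ⟨⟨h1, h2⟩, rfl⟩ := h
        exact ⟨j, by simp [mrRow, h1], rfl⟩
    · intro p hp
      simp [hD] at hp
      exact hp.2
  have hr : Module.finrank F ((V → F) × ({x // x ∈ I.erase i0} → Fin b → F))
      = V.card + (I.card - 1) * b := by
    rw [Module.finrank_prod, Module.finrank_pi, Module.finrank_pi_fintype]
    simp [Finset.card_erase_of_mem hi0]
  rw [hr, Module.finrank_pi, Fintype.card_coe, hcard] at hle
  have hpos : 1 ≤ I.card := Finset.card_pos.mpr ⟨i0, hi0⟩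
  obtain ⟨k, hk⟩ := Nat.exists_eq_add_of_le' hpos
  rw [hk] at hle ⊢
  simp only [Nat.add_sub_cancel] at hle
  nlinarith

/-- Supports of the rows of the generic generator matrix. -/
def mrSupp {m n N : ℕ} (A : Fin m → Finset (Fin n)) (τ : Fin N → Option (Fin m)) (r : Fin N) :
    Finset (Fin n) :=
  match τ r with
  | some i => A i
  | none => Finset.univ

theorem mr_exists_type {m N : ℕ} (d : Fin m → ℕ) (hd : ∑ i, d i ≤ N) :
    ∃ τ : Fin N → Option (Fin m), ∀ i, (Finset.univ.filter (fun r => τ r = some i)).card = d i := by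
  classical
  have hc : Fintype.card ((Σ i, Fin (d i)) ⊕ Fin (N - ∑ i, d i)) = Fintype.card (Fin N) := by
    simp
    omega
  let e := Fintype.equivOfCardEq hc
  refine ⟨fun r => Sum.elim (fun x => some x.1) (fun _ => none) (e.symm r), fun i => ?_⟩
  have : (Finset.univ.filter (fun r => (Sum.elim (fun x => some x.1) (fun _ => none) (e.symm r) :
      Option (Fin m)) = some i)) = Finset.univ.image (fun t : Fin (d i) => e (Sum.inl ⟨i, t⟩)) := by
    ext r
    simp only [Finset.mem_filter, Finset.mem_univ, true_and, Finset.mem_image]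
    constructor
    · intro h
      obtain ⟨x, rfl⟩ := e.surjective r
      rw [Equiv.symm_apply_apply] at h
      rcases x with ⟨a, t⟩ | x
      · simp at h
        subst h
        exact ⟨t, rfl⟩
      · simp at h
    · rintro ⟨t, rfl⟩
      simp
  rw [this, Finset.card_image_of_injective]
  · simp
  · intro a b h
    simpa using h

theorem mr_hall {m n N : ℕ} (A : Fin m → Finset (Fin n)) (d : Fin m → ℕ)
    (τ : Fin N → Option (Fin m))
    (hτ : ∀ i, (Finset.univ.filter (fun r => τ r = some i)).card = d i)
    (p : Fin N → Prop) (D : Finset (Fin n))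
    (h1 : Nat.card {r // p r} + D.card ≤ n)
    (h2 : ∀ I : Finset (Fin m), I.Nonempty → (∀ i ∈ I, ∃ r, p r ∧ τ r = some i) →
      ∑ i ∈ I, d i ≤ (I.biUnion A \ D).card) :
    ∃ f : {r // p r} → Fin n, Function.Injective f ∧ ∀ r, f r ∈ mrSupp A τ r.1 \ D := by
  classical
  rw [← Finset.all_card_le_biUnion_card_iff_exists_injective (fun r : {r // p r} => mrSupp A τ r.1 \ D)]
  intro J
  by_cases hJ : ∃ r ∈ J, τ r.1 = none
  · obtain ⟨r, hr, hr'⟩ := hJ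
    have hs : Dᶜ ⊆ J.biUnion (fun r : {r // p r} => mrSupp A τ r.1 \ D) := by
      intro x hx
      rw [Finset.mem_biUnion]
      exact ⟨r, hr, by simpa [mrSupp, hr'] using hx⟩
    have := Finset.card_le_card hs
    rw [Finset.card_compl, Fintype.card_fin] at this
    have h3 : J.card ≤ Nat.card {r // p r} := by
      rw [Nat.card_eq_fintype_card]
      exact Finset.card_le_univ J
    omega
  · push Not at hJ
    rcases J.eq_empty_or_nonempty with rfl | hne
    · simp
    set I : Finset (Fin m) := Finset.univ.filter (fun i => ∃ r ∈ J, τ r.1 = some i) with hI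
    have hJI : ∀ r ∈ J, ∃ i ∈ I, τ r.1 = some i := by
      intro r hr
      obtain ⟨i, hi⟩ := Option.ne_none_iff_exists'.mp (hJ r hr)
      exact ⟨i, by simp only [hI, Finset.mem_filter, Finset.mem_univ, true_and]; exact ⟨r, hr, hi⟩, hi⟩
    have hIne : I.Nonempty := by
      obtain ⟨r, hr⟩ := hne
      obtain ⟨i, hi, _⟩ := hJI r hr
      exact ⟨i, hi⟩
    have hb1 : J.card ≤ ∑ i ∈ I, d i := by
      have : J.map ⟨Subtype.val, Subtype.val_injective⟩ ⊆
          I.biUnion (fun i => Finset.univ.filter (fun r => τ r = some i)) := by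
        intro x hx
        rw [Finset.mem_map] at hx
        obtain ⟨r, hr, rfl⟩ := hx
        obtain ⟨i, hi, h⟩ := hJI r hr
        rw [Finset.mem_biUnion]
        exact ⟨i, hi, by simpa using h⟩
      have h3 := Finset.card_le_card this
      rw [Finset.card_map] at h3
      refine h3.trans (Finset.card_biUnion_le.trans (le_of_eq ?_))
      exact Finset.sum_congr rfl (fun i _ => hτ i)
    refine hb1.trans ((h2 I hIne ?_).trans (Finset.card_le_card ?_))
    · intro i hi
      simp only [hI, Finset.mem_filter, Finset.mem_univ, true_and] at hi
      obtain ⟨r, _, h⟩ := hi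
      exact ⟨r.1, r.2, h⟩
    · intro x hx
      simp only [Finset.mem_sdiff, Finset.mem_biUnion] at hx ⊢
      obtain ⟨⟨i, hi, hxi⟩, hxD⟩ := hx
      simp only [hI, Finset.mem_filter, Finset.mem_univ, true_and] at hi
      obtain ⟨r, hr, h⟩ := hi
      exact ⟨r, hr, by simpa [mrSupp, h] using hxi, hxD⟩

/-- Field of rational functions. -/
abbrev MrL (F : Type) [Field F] (N n : ℕ) : Type := FractionRing (MvPolynomial (Fin N × Fin n) F)

/-- Generic matrix with given row supports. -/
noncomputable def mrGen (F : Type) [Field F] {N n : ℕ} (B : Fin N → Finset (Fin n)) :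
    Matrix (Fin N) (Fin n) (MrL F N n) :=
  fun r j => algebraMap (MvPolynomial (Fin N × Fin n) F) _
    (if j ∈ B r then MvPolynomial.X (r, j) else 0)

theorem mr_generic_indep (F : Type) [Field F] {N n : ℕ} (B : Fin N → Finset (Fin n))
    (p : Fin N → Prop) (f : {r // p r} → Fin n) (hf : Function.Injective f)
    (hfB : ∀ r, f r ∈ B r.1) (y : Fin N → MrL F N n) (hy : ∀ r, ¬ p r → y r = 0)
    (h0 : ∀ r, Matrix.vecMul y (mrGen F B) (f r) = 0) : y = 0 := by
  classical
  let P : Matrix {r // p r} {r // p r} (MvPolynomial (Fin N × Fin n) F) :=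
    fun r r' => if f r' ∈ B r.1 then MvPolynomial.X (r.1, f r') else 0
  have hP : P.det ≠ 0 := by
    intro h
    let x : Fin N × Fin n → F := fun v => if ∃ h : p v.1, f ⟨v.1, h⟩ = v.2 then 1 else 0
    have h1 := congrArg (MvPolynomial.eval x) h
    rw [RingHom.map_det] at h1
    have h2 : (MvPolynomial.eval x).mapMatrix P = 1 := by
      ext r r'
      rw [RingHom.mapMatrix_apply, Matrix.map_apply]
      change MvPolynomial.eval x (if f r' ∈ B r.1 then MvPolynomial.X (r.1, f r') else 0) = _
      by_cases hr : r = r'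
      · subst hr
        rw [if_pos (hfB r), MvPolynomial.eval_X, Matrix.one_apply_eq]
        exact if_pos ⟨r.2, rfl⟩
      · have hne : f r ≠ f r' := fun h => hr (hf h)
        rw [Matrix.one_apply_ne hr]
        by_cases hB : f r' ∈ B r.1
        · rw [if_pos hB, MvPolynomial.eval_X]
          exact if_neg (fun ⟨_, h⟩ => hne h)
        · rw [if_neg hB, map_zero]
    rw [h2] at h1
    simp at h1
  have hQ : ((algebraMap (MvPolynomial (Fin N × Fin n) F) (MrL F N n)).mapMatrix P).det ≠ 0 := by
    rw [← RingHom.map_det]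
    intro h
    apply hP
    exact (IsFractionRing.injective (MvPolynomial (Fin N × Fin n) F) (MrL F N n)) (by simpa using h)
  have hv : Matrix.vecMul (fun r : {r // p r} => y r.1)
      ((algebraMap (MvPolynomial (Fin N × Fin n) F) (MrL F N n)).mapMatrix P) = 0 := by
    ext r'
    rw [Pi.zero_apply, ← h0 r']
    simp only [Matrix.vecMul, dotProduct]
    have h3 := Fintype.sum_subtype_add_sum_subtype p (fun r => y r * mrGen F B r (f r'))
    have h4 : ∑ r : {r // ¬ p r}, y r.1 * mrGen F B r.1 (f r') = 0 :=
      Finset.sum_eq_zero (fun r _ => by rw [hy r.1 r.2, zero_mul])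
    rw [h4, add_zero] at h3
    rw [← h3]
    rfl
  have hz := Matrix.eq_zero_of_vecMul_eq_zero hQ hv
  ext r
  by_cases hr : p r
  · exact congrFun hz ⟨r, hr⟩
  · exact hy r hr

/-- The code with all-ones column check and row check matrix `H` corrects `E`. -/
def MrGood (K : Type) [Field K] {m n b : ℕ} (E : Finset (Fin m × Fin n))
    (H : Matrix (Fin b) (Fin n) K) : Prop :=
  ∀ c : Fin m → Fin n → K, (∀ i j, (i, j) ∉ E → c i j = 0) → (∀ j, ∑ i, c i j = 0) →
    (∀ i, H.mulVec (c i) = 0) → c = 0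

theorem mr_exists_check {K : Type} [Field K] {N n b : ℕ} (hn : N + b = n)
    (G : Matrix (Fin N) (Fin n) K) (hG : ∀ y, Matrix.vecMul y G = 0 → y = 0) :
    ∃ H : Matrix (Fin b) (Fin n) K, ∀ v, H.mulVec v = 0 → ∃ y, Matrix.vecMul y G = v := by
  classical
  let R := LinearMap.range G.vecMulLinear
  have hinj : Function.Injective G.vecMulLinear := by
    rw [← LinearMap.ker_eq_bot, LinearMap.ker_eq_bot']
    intro y hy
    exact hG y (by simpa using hy)
  have hR : Module.finrank K R = N := by
    rw [LinearMap.finrank_range_of_inj hinj]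
    simp
  have hQ : Module.finrank K ((Fin n → K) ⧸ R) = Module.finrank K (Fin b → K) := by
    have := Submodule.finrank_quotient_add_finrank R
    rw [hR] at this
    simp at this ⊢
    omega
  let e := LinearEquiv.ofFinrankEq _ _ hQ
  refine ⟨LinearMap.toMatrix' (e.toLinearMap.comp R.mkQ), fun v hv => ?_⟩
  rw [LinearMap.toMatrix'_mulVec] at hv
  have h1 : R.mkQ v = 0 := e.map_eq_zero_iff.mp hv
  have h2 : v ∈ R := by simpa using h1
  obtain ⟨y, hy⟩ := h2
  exact ⟨y, by simpa using hy⟩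

theorem mr_generic_good (F : Type) [Field F] {m n b : ℕ} (hb : b ≤ n) (E : Finset (Fin m × Fin n))
    (hE : MrRegular b (mrRow E)) :
    ∃ H : Matrix (Fin b) (Fin n) (MrL F (n - b) n), MrGood (MrL F (n - b) n) E H := by
  classical
  set A := mrRow E with hA
  let d : Fin m → ℕ := fun i => (A i).card - b
  have core : ∀ I : Finset (Fin m), I.Nonempty → (∀ i ∈ I, 0 < d i) →
      ∑ i ∈ I, d i + b ≤ (I.biUnion A).card := by
    intro I hI hd
    have h1 := hE I hI
    have h2 : ∑ i ∈ I, (A i).card = ∑ i ∈ I, d i + I.card * b := by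
      rw [← smul_eq_mul, ← Finset.sum_const, ← Finset.sum_add_distrib]
      apply Finset.sum_congr rfl
      intro i hi
      have := hd i hi
      simp only [d] at this ⊢
      omega
    rw [h2] at h1
    nlinarith
  have hsum : ∑ i, d i ≤ n - b := by
    have h0 : ∑ i, d i = ∑ i ∈ Finset.univ.filter (fun i => 0 < d i), d i := by
      rw [Finset.sum_filter]
      apply Finset.sum_congr rfl
      intro i _
      split_ifs <;> omega
    rw [h0]
    rcases (Finset.univ.filter (fun i => 0 < d i)).eq_empty_or_nonempty with h | h
    · rw [h]; simp
    · have h1 := core _ h (by simp)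
      have h2 := Finset.card_le_univ ((Finset.univ.filter (fun i => 0 < d i)).biUnion A)
      rw [Fintype.card_fin] at h2
      omega
  obtain ⟨τ, hτ⟩ := mr_exists_type d hsum
  have hpos : ∀ r i, τ r = some i → 0 < d i := by
    intro r i h
    rw [← hτ i, Finset.card_pos]
    exact ⟨r, by simpa using h⟩
  set G := mrGen F (mrSupp A τ) with hGdef
  have hall1 : ∀ y, Matrix.vecMul y G = 0 → y = 0 := by
    obtain ⟨f, hf, hfB⟩ := mr_hall A d τ hτ (fun _ => True) ∅ (by simp) (by
      intro I hI h
      have := core I hI (fun i hi => by obtain ⟨r, _, h⟩ := h i hi; exact hpos r i h)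
      rw [Finset.sdiff_empty]
      omega)
    intro y hy
    refine mr_generic_indep F (mrSupp A τ) (fun _ => True) f hf (fun r => ?_) y (by simp) ?_
    · exact (Finset.mem_sdiff.mp (hfB r)).1
    · intro r
      exact congrFun hy (f r)
  have hall2 : ∀ i y, (∀ r, τ r = some i → y r = 0) →
      (∀ j, j ∉ A i → Matrix.vecMul y G j = 0) → y = 0 := by
    intro i
    obtain ⟨f, hf, hfB⟩ := mr_hall A d τ hτ (fun r => τ r ≠ some i) (A i) (by
      have h1 : Nat.card {r // τ r ≠ some i} = n - b - d i := by
        rw [Nat.card_eq_fintype_card, Fintype.card_subtype_compl, Fintype.card_fin,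
          Fintype.card_subtype, hτ i]
      have h2 : d i ≤ n - b :=
        (Finset.single_le_sum (fun _ _ => Nat.zero_le _) (Finset.mem_univ i)).trans hsum
      have h3 := Finset.card_le_univ (A i)
      rw [Fintype.card_fin] at h3
      rw [h1]
      simp only [d] at h2 ⊢
      omega) (by
      intro I hI h
      have hI' : ∀ k ∈ I, 0 < d k := fun k hk => by
        obtain ⟨r, _, h⟩ := h k hk; exact hpos r k h
      have hiI : i ∉ I := fun hi => by
        obtain ⟨r, h1, h2⟩ := h i hi; exact h1 h2
      by_cases hdi : 0 < d i
      · have h1 := core (insert i I) (Finset.insert_nonempty _ _) (by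
          intro k hk
          rcases Finset.mem_insert.mp hk with rfl | hk
          · exact hdi
          · exact hI' k hk)
        rw [Finset.sum_insert hiI, Finset.biUnion_insert, ← Finset.union_sdiff_self_eq_union,
          Finset.card_union_of_disjoint Finset.disjoint_sdiff] at h1
        simp only [d] at h1 hdi ⊢
        omega
      · have h1 := core I hI hI'
        have h2 := Finset.le_card_sdiff (A i) (I.biUnion A)
        simp only [d] at h1 hdi ⊢
        omega)
    intro y hy h0
    refine mr_generic_indep F (mrSupp A τ) (fun r => τ r ≠ some i) f hf (fun r => ?_) y
      (fun r hr => hy r (not_not.mp hr)) ?_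
    · exact (Finset.mem_sdiff.mp (hfB r)).1
    · intro r
      exact h0 _ (Finset.mem_sdiff.mp (hfB r)).2
  obtain ⟨H, hH⟩ := mr_exists_check (b := b) (by omega) G hall1
  refine ⟨H, fun c hcE hcs hcH => ?_⟩
  choose y hy using fun i => hH (c i) (hcH i)
  have hsupp : ∀ i r, τ r ≠ some i → y i r = 0 := by
    intro i
    have h1 := hall2 i (fun r => if τ r = some i then 0 else y i r) (by
      intro r h; simp [h]) (by
      intro j hj
      have h2 : c i j = 0 := hcE i j (by simpa [hA, mrRow] using hj)
      rw [← hy i] at h2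
      rw [← h2]
      simp only [Matrix.vecMul, dotProduct]
      apply Finset.sum_congr rfl
      intro r _
      by_cases h : τ r = some i
      · have : G r j = 0 := by
          simp [hGdef, mrGen, mrSupp, h, hj]
        rw [this, mul_zero, mul_zero]
      · rw [if_neg h])
    intro r hr
    have := congrFun h1 r
    simpa [hr] using this
  have hys : ∑ i, y i = 0 := by
    apply hall1
    rw [Matrix.sum_vecMul]
    ext j
    simp only [hy]
    simpa using hcs j
  ext i j
  have hyi : y i = 0 := by
    ext r
    by_cases h : τ r = some i
    · have h1 := congrFun hys r
      rw [Finset.sum_apply, Finset.sum_eq_single i] at h1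
      · exact h1
      · intro k _ hk
        apply hsupp k r
        rw [h]
        intro h'
        exact hk (Option.some.inj h').symm
      · simp
    · exact hsupp i r h
  rw [← hy i, hyi]
  simp

/-- The matrix of the linear system for the erased entries. -/
def mrSys {R : Type} [CommRing R] {m n b : ℕ} (E : Finset (Fin m × Fin n))
    (h : Fin b × Fin n → R) : Matrix (Fin n ⊕ (Fin m × Fin b)) E R :=
  fun r e => Sum.elim (fun j => if e.1.2 = j then 1 else 0)
    (fun ik => if e.1.1 = ik.1 then h (ik.2, e.1.2) else 0) r

theorem mr_sys_mulVec {K : Type} [Field K] {m n b : ℕ} (E : Finset (Fin m × Fin n))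
    (h : Fin b × Fin n → K) (c : E → K) :
    (∀ j, (mrSys E h).mulVec c (Sum.inl j) = ∑ i, mrExt E c i j) ∧
    ∀ i k, (mrSys E h).mulVec c (Sum.inr (i, k)) =
      Matrix.mulVec (fun k j => h (k, j)) (mrExt E c i) k := by
  classical
  have key : ∀ g : Fin m × Fin n → K, ∑ e : E, g e.1 * c e = ∑ i, ∑ j, g (i, j) * mrExt E c i j := by
    intro g
    rw [← Fintype.sum_prod_type' (fun i j => g (i, j) * mrExt E c i j)]
    rw [← Finset.sum_subset (Finset.subset_univ E), ← Finset.sum_coe_sort E]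
    · apply Finset.sum_congr rfl
      intro e _
      simp [mrExt]
    · intro p _ hp
      simp [mrExt, hp]
  constructor
  · intro j
    have := key (fun p => if p.2 = j then 1 else 0)
    simp only [Matrix.mulVec, dotProduct, mrSys, Sum.elim_inl]
    rw [this]
    simp
  · intro i k
    have := key (fun p => if p.1 = i then h (k, p.2) else 0)
    simp only [Matrix.mulVec, dotProduct, mrSys, Sum.elim_inr]
    rw [this, Finset.sum_eq_single i]
    · simp
    · intro a _ ha
      simp [ha]
    · simp

theorem mr_good_iff {K : Type} [Field K] {m n b : ℕ} (E : Finset (Fin m × Fin n))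
    (h : Fin b × Fin n → K) :
    MrGood K E (fun k j => h (k, j)) ↔ ∀ c, (mrSys E h).mulVec c = 0 → c = 0 := by
  classical
  constructor
  · intro hg c hc
    have h1 := mr_sys_mulVec E h c
    have h2 := hg (mrExt E c) (fun i j hij => by simp [mrExt, hij])
      (fun j => by rw [← h1.1 j, hc]; rfl)
      (fun i => by ext k; rw [← h1.2 i k, hc]; rfl)
    ext ⟨⟨i, j⟩, he⟩
    have := congrFun (congrFun h2 i) j
    simpa [mrExt, he] using this
  · intro hs c hcE hcs hcH
    have hx : mrExt E (fun e : E => c e.1.1 e.1.2) = c := by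
      ext i j
      by_cases hij : (i, j) ∈ E
      · simp [mrExt, hij]
      · simp [mrExt, hij, hcE]
    have h1 := mr_sys_mulVec E h (fun e : E => c e.1.1 e.1.2)
    rw [hx] at h1
    have h2 := hs (fun e : E => c e.1.1 e.1.2) (by
      ext r
      rcases r with j | ⟨i, k⟩
      · rw [h1.1 j]; exact hcs j
      · rw [h1.2 i k]; exact congrFun (hcH i) k)
    rw [← hx, h2, map_zero]

theorem mr_poly {K : Type} [Field K] {m n b : ℕ} (E : Finset (Fin m × Fin n)) :
    ∃ P : MvPolynomial (Fin b × Fin n) K, P ≠ 0 ∧ (∀ v, P.degreeOf v ≤ E.card) ∧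
      ((∃ H : Matrix (Fin b) (Fin n) K, MrGood K E H) →
        ∀ h, MvPolynomial.eval h P ≠ 0 → MrGood K E (fun k j => h (k, j))) := by
  classical
  by_cases hH : ∃ H : Matrix (Fin b) (Fin n) K, MrGood K E H
  swap
  · exact ⟨1, one_ne_zero, fun v => by simp [MvPolynomial.degreeOf_one], fun h => absurd h hH⟩
  obtain ⟨H, hg⟩ := hH
  have hg' := (mr_good_iff E (fun v => H v.1 v.2)).mp hg
  obtain ⟨φ, hφ⟩ := LinearMap.exists_leftInverse_of_injective
    (mrSys E (fun v => H v.1 v.2)).mulVecLin (LinearMap.ker_eq_bot'.mpr hg')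
  set B := LinearMap.toMatrix' φ with hB
  have hBM : B * mrSys E (fun v => H v.1 v.2) = 1 := by
    have := congrArg LinearMap.toMatrix' hφ
    rw [LinearMap.toMatrix'_comp, LinearMap.toMatrix'_id] at this
    rw [← this, hB]
    congr 1
    exact (LinearMap.toMatrix'_toLin' _).symm
  let M : Matrix E E (MvPolynomial (Fin b × Fin n) K) :=
    fun e e' => ∑ r, MvPolynomial.C (B e r) * mrSys E MvPolynomial.X r e'
  have hev : ∀ h : Fin b × Fin n → K, MvPolynomial.eval h M.det = (B * mrSys E h).det := by
    intro h
    rw [RingHom.map_det]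
    congr 1
    ext e e'
    rw [RingHom.mapMatrix_apply, Matrix.map_apply, Matrix.mul_apply]
    simp only [M]
    rw [map_sum]
    apply Finset.sum_congr rfl
    intro r _
    rw [map_mul, MvPolynomial.eval_C]
    congr 1
    rcases r with j | ⟨i, k⟩
    · by_cases hj : e'.1.2 = j <;> simp [mrSys, hj]
    · by_cases hj : e'.1.1 = i <;> simp [mrSys, hj]
  refine ⟨M.det, ?_, ?_, ?_⟩
  · intro h0
    have := hev (fun v => H v.1 v.2)
    rw [hBM, h0] at this
    simp at this
  · intro v
    have hent : ∀ e e', (M e e').degreeOf v ≤ 1 := by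
      intro e e'
      simp only [M]
      refine (MvPolynomial.degreeOf_sum_le v _ _).trans (Finset.sup_le fun r _ => ?_)
      refine (MvPolynomial.degreeOf_C_mul_le _ _ _).trans ?_
      rcases r with j | ⟨i, k⟩
      · by_cases hj : e'.1.2 = j <;> simp [mrSys, hj, MvPolynomial.degreeOf_one]
      · by_cases hj : e'.1.1 = i
        · simp only [mrSys, hj, Sum.elim_inr, if_true]
          rw [MvPolynomial.degreeOf_X]
          split_ifs <;> simp
        · simp [mrSys, hj]
    rw [Matrix.det_apply']
    refine (MvPolynomial.degreeOf_sum_le v _ _).trans (Finset.sup_le fun σ _ => ?_)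
    refine (MvPolynomial.degreeOf_mul_le _ _ _).trans ?_
    have h1 : MvPolynomial.degreeOf v
        (((Equiv.Perm.sign σ : ℤ) : MvPolynomial (Fin b × Fin n) K)) = 0 := by
      rw [← map_intCast (MvPolynomial.C : K →+* MvPolynomial (Fin b × Fin n) K)]
      exact MvPolynomial.degreeOf_C _ _
    rw [h1, zero_add]
    refine (MvPolynomial.degreeOf_prod_le _ _ _).trans ?_
    refine (Finset.sum_le_sum (fun e _ => hent _ _)).trans ?_
    simp
  · intro _ h hne
    rw [mr_good_iff]
    intro c hc
    rw [hev] at hne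
    apply Matrix.eq_zero_of_mulVec_eq_zero hne
    rw [← Matrix.mulVec_mulVec, hc, Matrix.mulVec_zero]

theorem mr_count {m n b : ℕ} (hm : 1 ≤ m) (hn : 0 < n) (E : Finset (Fin m × Fin n))
    (hE : MrRegular b (mrRow E))
    (h2 : ∀ p ∈ E, 2 ≤ (Finset.univ.filter (fun i => (i, p.2) ∈ E)).card) :
    ∃ (φ : Fin (b * (m - 1)) → Fin n) (S : Finset (Fin m × Fin (b * (m - 1)))),
      S.card ≤ 2 * (b * (m - 1)) ∧ S.image (fun p => (p.1, φ p.2)) = E := by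
  classical
  set V := E.image Prod.snd with hV
  have hcore := hE Finset.univ ⟨⟨0, hm⟩, Finset.mem_univ _⟩
  have e1 : ∑ i, (mrRow E i).card = E.card := by
    rw [Finset.card_eq_sum_card_fiberwise (f := Prod.fst) (t := Finset.univ)
      (fun _ _ => Finset.mem_coe.mpr (Finset.mem_univ _))]
    apply Finset.sum_congr rfl
    intro i _
    apply Finset.card_bij (fun j _ => (i, j))
    · intro j hj
      simp [mrRow] at hj
      simp [hj]
    · intro a _ b _ h
      simpa using h
    · rintro ⟨a, j⟩ h
      simp at h
      obtain ⟨h1, rfl⟩ := h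
      exact ⟨j, by simp [mrRow, h1], rfl⟩
  have e2 : Finset.univ.biUnion (mrRow E) = V := by
    ext j
    simp [hV, mrRow]
  have e3 : V.card * 2 ≤ E.card := by
    rw [Finset.card_eq_sum_card_image Prod.snd E, ← smul_eq_mul]
    apply Finset.card_nsmul_le_sum
    intro j hj
    obtain ⟨p, hp, rfl⟩ := Finset.mem_image.mp hj
    refine (h2 p hp).trans ?_
    apply Finset.card_le_card_of_injOn (fun i => (i, p.2))
    · intro i hi
      simp at hi
      simp [hi]
    · intro a _ b _ h
      simpa using h
  rw [e1, e2, Finset.card_univ, Fintype.card_fin] at hcore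
  obtain ⟨k, rfl⟩ := Nat.exists_eq_add_of_le' hm
  simp only [Nat.add_sub_cancel] at *
  have hVs : V.card ≤ b * k := by nlinarith
  have hEs : E.card ≤ 2 * (b * k) := by nlinarith
  obtain ⟨g⟩ := Function.Embedding.nonempty_of_card_le (α := V) (β := Fin (b * k))
    (by simpa using hVs)
  refine ⟨Function.extend g Subtype.val (fun _ => ⟨0, hn⟩),
    E.attach.image (fun p => (p.1.1, g ⟨p.1.2, Finset.mem_image_of_mem _ p.2⟩)), ?_, ?_⟩
  · exact Finset.card_image_le.trans (by simpa using hEs)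
  · rw [Finset.image_image]
    ext p
    simp only [Finset.mem_image, Finset.mem_attach, true_and, Function.comp,
      g.injective.extend_apply]
    constructor
    · rintro ⟨a, rfl⟩
      exact a.2
    · intro hp
      exact ⟨⟨p, hp⟩, rfl⟩

theorem mr_card_small (t k : ℕ) (α : Type) [Fintype α] [DecidableEq α] (hα : Fintype.card α = t) :
    ((Finset.univ : Finset (Finset α)).filter (fun S => S.card ≤ k)).card =
      ∑ i ∈ Finset.range (k + 1), Nat.choose t i := by
  rw [Finset.card_eq_sum_card_fiberwise (f := Finset.card) (t := Finset.range (k + 1))]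
  · apply Finset.sum_congr rfl
    intro i hi
    rw [← hα, ← Finset.card_univ, ← Finset.card_powersetCard]
    congr 1
    ext S
    simp only [Finset.mem_range] at hi
    simp only [Finset.mem_filter, Finset.mem_univ, true_and, Finset.mem_powersetCard,
      Finset.subset_univ]
    constructor
    · exact fun h => h.2
    · intro h
      exact ⟨by omega, h⟩
  · intro S hS
    simp at hS
    simp
    omega

theorem mr_good_descend {F K : Type} [Field F] [Field K] (f : F →+* K) {m n b : ℕ}
    (E : Finset (Fin m × Fin n)) (H : Matrix (Fin b) (Fin n) F)
    (h : MrGood K E (fun k j => f (H k j))) : MrGood F E H := by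
  intro c h1 h2 h3
  have := h (fun i j => f (c i j)) (fun i j hij => by rw [h1 i j hij, map_zero])
    (fun j => by rw [← map_sum, h2 j, map_zero])
    (fun i => by
      ext k
      have := congrArg f (congrFun (h3 i) k)
      simpa [Matrix.mulVec, dotProduct] using this)
  ext i j
  have := congrFun (congrFun this i) j
  simpa using this
/-- for `m, b ≥ 1`, `n ≥ b + 1` and any power of two
`q ≥ C₀(m,b) · n^(2b(m-1)) + n^(b-1)` where
`C₀(m,b) = (m+1)! · ∑_{i ≤ 2b(m-1)} C(m·b(m-1), i)`, there is a maximally recoverable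
code instantiating `T_{m×n}(1,b,0)` over the field with `q` elements. -/
theorem exists_MR_code_T_m_n_1_b_0 (m b n : ℕ) (hm : 1 ≤ m) (hb : 1 ≤ b) (hn : b + 1 ≤ n)
    (q : ℕ) (hq2 : ∃ k : ℕ, q = 2 ^ k)
    (hq : (m + 1).factorial *
        (∑ i ∈ Finset.range (2 * b * (m - 1) + 1), Nat.choose (m * (b * (m - 1))) i) *
        n ^ (2 * b * (m - 1)) + n ^ (b - 1) ≤ q)
    (F : Type) [Field F] [Fintype F] (hF : Fintype.card F = q) :
    ∃ C : Set (Matrix (Fin m) (Fin n) F), IsMaximallyRecoverable F m n 1 b C := by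
  classical
  set s := b * (m - 1) with hs
  have hs2 : 2 * b * (m - 1) = 2 * s := by rw [hs, mul_assoc]
  rw [hs2] at hq
  let K := MrL F (n - b) n
  choose P hP0 hPd hPg using fun E : Finset (Fin m × Fin n) => mr_poly (K := K) (b := b) E
  let patt : (Fin s → Fin n) × Finset (Fin m × Fin s) → Finset (Fin m × Fin n) :=
    fun x => x.2.image (fun p => (p.1, x.1 p.2))
  let J : Finset ((Fin s → Fin n) × Finset (Fin m × Fin s)) :=
    Finset.univ ×ˢ (Finset.univ.filter (fun S => S.card ≤ 2 * s))
  set Sg := ∑ i ∈ Finset.range (2 * s + 1), Nat.choose (m * s) i with hSg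
  have hJ : J.card = n ^ s * Sg := by
    rw [Finset.card_product, mr_card_small (m * s) (2 * s) (Fin m × Fin s) (by simp), hSg]
    congr 1
    simp
  let Q := ∏ x ∈ J, P (patt x)
  have hQ0 : Q ≠ 0 := Finset.prod_ne_zero_iff.mpr (fun x _ => hP0 _)
  have hQd : ∀ v, Q.degreeOf v < q := by
    intro v
    have h1 : Q.degreeOf v ≤ J.card * (2 * s) := by
      refine (MvPolynomial.degreeOf_prod_le _ _ _).trans ?_
      rw [← smul_eq_mul]
      apply Finset.sum_le_card_nsmul
      intro x hx
      refine (hPd _ v).trans (Finset.card_image_le.trans ?_)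
      simpa [J] using hx
    have h2 : s < n ^ s := Nat.lt_pow_self (by omega)
    have h3 : 2 ≤ (m + 1).factorial := by
      have := Nat.self_le_factorial (m + 1)
      omega
    have h4 : 0 < n ^ (b - 1) := Nat.pow_pos (by omega)
    have h5 : 2 * s ≤ (m + 1).factorial * n ^ s := Nat.mul_le_mul h3 h2.le
    have h6 : J.card * (2 * s) ≤ (m + 1).factorial * Sg * n ^ (2 * s) := by
      rw [hJ]
      calc n ^ s * Sg * (2 * s) ≤ n ^ s * Sg * ((m + 1).factorial * n ^ s) :=
            Nat.mul_le_mul_left _ h5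
        _ = (m + 1).factorial * Sg * n ^ (2 * s) := by ring
    omega
  have hinj : Function.Injective (algebraMap F K) := (algebraMap F K).injective
  obtain ⟨x, hx, hxQ⟩ : ∃ x : Fin b × Fin n → K,
      (∀ v, x v ∈ Finset.univ.image (algebraMap F K)) ∧ MvPolynomial.eval x Q ≠ 0 := by
    by_contra hcon
    push Not at hcon
    apply hQ0
    apply MvPolynomial.eq_zero_of_eval_zero_at_prod_finset Q
      (fun _ => Finset.univ.image (algebraMap F K))
    · intro v
      rw [Finset.card_image_of_injective _ hinj, Finset.card_univ, hF]
      exact hQd v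
    · exact hcon
  have hx' : ∀ v, ∃ h : F, algebraMap F K h = x v := by
    intro v
    simpa using hx v
  choose h hh using hx'
  refine ⟨_, ⟨fun _ _ => 1, fun k j => h (k, j), rfl⟩, ?_⟩
  rintro E ⟨F', fi, ft, C', hC', hCE⟩
  set Er := E.filter (fun p => 2 ≤ (Finset.univ.filter (fun i => (i, p.2) ∈ E)).card) with hEr
  have hreg : MrRegular b (mrRow Er) := by
    apply mr_regular_of_corrects C' hC'
    intro c1 h1 c2 h2 h12
    apply hCE c1 h1 c2 h2
    intro p hp
    exact h12 p (fun hp' => hp (Finset.filter_subset _ _ hp'))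
  obtain ⟨φ, S, hS, hSE⟩ := mr_count hm (by omega) Er hreg (by
    intro p hp
    have hp' := (Finset.mem_filter.mp hp).2
    refine hp'.trans (Finset.card_le_card ?_)
    intro i hi
    simp only [Finset.mem_filter, Finset.mem_univ, true_and] at hi
    simp only [hEr, Finset.mem_filter, Finset.mem_univ, true_and]
    exact ⟨hi, hp'⟩)
  have hgood : MrGood F Er (fun k j => h (k, j)) := by
    apply mr_good_descend (algebraMap F K)
    have h1 := hPg Er (mr_generic_good F (by omega) Er hreg) x (by
      have h2 := hxQ
      simp only [Q] at h2
      rw [map_prod, Finset.prod_ne_zero_iff] at h2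
      have h3 := h2 (φ, S) (by simpa [J] using hS)
      have h4 : patt (φ, S) = Er := hSE
      rwa [h4] at h3)
    simpa only [hh] using h1
  intro c1 h1 c2 h2 h12
  have hcol : ∀ j, ∑ i, (c1 - c2) i j = 0 := by
    intro j
    have a1 := congrFun (h1.1 j) 0
    have a2 := congrFun (h2.1 j) 0
    simp only [Matrix.mulVec, dotProduct, one_mul, Pi.zero_apply] at a1 a2
    simp only [Matrix.sub_apply, Finset.sum_sub_distrib, a1, a2, sub_zero]
  have hsub : ∀ p : Fin m × Fin n, p ∉ E → (c1 - c2) p.1 p.2 = 0 := by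
    intro p hp
    rw [Matrix.sub_apply, h12 p hp, sub_self]
  have := hgood (c1 - c2) (by
    intro i j hij
    by_cases hE : (i, j) ∈ E
    · rw [← hcol j, Finset.sum_eq_single i]
      · intro k _ hk
        apply hsub (k, j)
        intro hkE
        apply hij
        simp only [hEr, Finset.mem_filter]
        refine ⟨hE, ?_⟩
        apply Finset.one_lt_card.mpr
        exact ⟨i, by simpa using hE, k, by simpa using hkE, fun h => hk h.symm⟩
      · simp
    · exact hsub (i, j) hE) hcol (by
    intro i
    have a1 := h1.2 i
    have a2 := h2.2 i
    have : (c1 - c2) i = c1 i - c2 i := rfl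
    rw [this]
    refine (Matrix.mulVec_sub (Matrix.of fun k j => h (k, j)) (c1 i) (c2 i)).trans ?_
    exact (congrArg₂ (· - ·) a1 a2).trans (sub_zero _))
  exact sub_eq_zero.mp this
end

section
/- There exists an absolute constant C1 > 0 such that for all sufficiently large n and every prime power q with q > C1 · n^5 / log n, there exists a maximally recoverable code that instantiates the grid-like topology T_{4×n}(1,2,0) over the field F_q. -/
namespace MRProof

open Finset

section Shearer
variable {V : Type*} [DecidableEq V]

/-- independent subsets of `X`. -/
def Ind (X : Finset V) (E : Finset (Finset V)) : Finset (Finset V) :=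
  X.powerset.filter (fun Z => ∀ e ∈ E, ¬ e ⊆ Z)

theorem mem_Ind {X : Finset V} {E : Finset (Finset V)} {Z : Finset V} :
    Z ∈ Ind X E ↔ Z ⊆ X ∧ ∀ e ∈ E, ¬ e ⊆ Z := by
  simp [Ind]

/-- number of edges at `v` whose other vertices lie in `Z`. -/
def wt (E : Finset (Finset V)) (Z : Finset V) (v : V) : ℕ :=
  (E.filter (fun e => v ∈ e ∧ e.erase v ⊆ Z)).card

/-- available link edges. -/
def avail (E : Finset (Finset V)) (v : V) (Z : Finset V) : Finset (Finset V) :=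
  E.filter (fun e => v ∈ e ∧ ∀ u ∈ e.erase v, ∀ f ∈ E, ¬ f ⊆ insert u Z)

/-- the neighbourhood of `v`. -/
def nbr (E : Finset (Finset V)) (v : V) : Finset V :=
  (E.filter (fun e => v ∈ e)).biUnion (fun e => e.erase v)

lemma mem_nbr {E : Finset (Finset V)} {v u : V} :
    u ∈ nbr E v ↔ ∃ e ∈ E, v ∈ e ∧ u ∈ e.erase v := by
  simp only [nbr, mem_biUnion, mem_filter, and_assoc]

lemma avail_sdiff {E : Finset (Finset V)} {v : V} {Z : Finset V}
    (h2 : ∀ f ∈ E, v ∉ f → ∀ u₁ ∈ f, ∀ u₂ ∈ f, u₁ ∈ nbr E v → u₂ ∈ nbr E v → u₁ = u₂)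
    (hZ : ∀ e ∈ E, ¬ e ⊆ Z) (hv : v ∉ Z) :
    avail E v Z = avail E v (Z \ nbr E v) := by
  ext e
  simp only [avail, mem_filter]
  constructor
  · rintro ⟨he, hve, h⟩
    refine ⟨he, hve, fun u hu f hf hfs => h u hu f hf (hfs.trans ?_)⟩
    exact insert_subset_insert _ sdiff_subset
  · rintro ⟨he, hve, h⟩
    refine ⟨he, hve, fun u hu f hf hfs => ?_⟩
    have hun : u ∈ nbr E v := mem_nbr.2 ⟨e, he, hve, hu⟩
    have huf : u ∈ f := by
      by_contra huf
      exact hZ f hf (fun x hx => by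
        rcases mem_insert.1 (hfs hx) with rfl | h'
        · exact absurd hx huf
        · exact h')
    have hvf : v ∉ f := by
      intro hvf
      rcases mem_insert.1 (hfs hvf) with h' | h'
      · exact (mem_erase.1 hu).1 h'.symm
      · exact hv h'
    refine h u hu f hf (fun x hx => ?_)
    rcases mem_insert.1 (hfs hx) with rfl | h'
    · exact mem_insert_self _ _
    · by_cases hxn : x ∈ nbr E v
      · rw [h2 f hf hvf x hx u huf hxn hun]; exact mem_insert_self _ _
      · exact mem_insert_of_mem (mem_sdiff.2 ⟨h', hxn⟩)

lemma avail_congr {E : Finset (Finset V)} {v : V} {Z Z' : Finset V}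
    (h2 : ∀ f ∈ E, v ∉ f → ∀ u₁ ∈ f, ∀ u₂ ∈ f, u₁ ∈ nbr E v → u₂ ∈ nbr E v → u₁ = u₂)
    (hZ : ∀ e ∈ E, ¬ e ⊆ Z) (hv : v ∉ Z) (hZ' : ∀ e ∈ E, ¬ e ⊆ Z') (hv' : v ∉ Z')
    (h : Z \ nbr E v = Z' \ nbr E v) : avail E v Z = avail E v Z' := by
  rw [avail_sdiff h2 hZ hv, avail_sdiff h2 hZ' hv', h]

lemma few_avail {X : Finset V} {E : Finset (Finset V)} {v : V}
    (hE : ∀ e ∈ E, e.card = 6) (hvX : v ∈ X)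
    (h2 : ∀ f ∈ E, v ∉ f → ∀ u₁ ∈ f, ∀ u₂ ∈ f, u₁ ∈ nbr E v → u₂ ∈ nbr E v → u₁ = u₂)
    (K : ℕ) :
    ((Ind X E).filter (fun Z => v ∉ Z ∧ (avail E v Z).card < K)).card
      ≤ 2 ^ K * ((Ind X E).filter (fun Z => v ∈ Z)).card := by
  have hpick : ∀ e : Finset V, ∃ u : V, e ∈ E → v ∈ e → u ∈ e.erase v := by
    intro e
    by_cases h : e ∈ E ∧ v ∈ e
    · have : (e.erase v).Nonempty := by
        rw [← card_pos, card_erase_of_mem h.2, hE e h.1]; norm_num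
      exact ⟨this.choose, fun _ _ => this.choose_spec⟩
    · exact ⟨v, fun h1 h2 => absurd ⟨h1, h2⟩ h⟩
  choose p hp using hpick
  set g : Finset V → Finset V := fun Z => insert v (Z \ (avail E v Z).image p) with hg
  have hUn : ∀ Z, (avail E v Z).image p ⊆ nbr E v := by
    intro Z x hx
    obtain ⟨e, he, rfl⟩ := mem_image.1 hx
    have he' := mem_filter.1 he
    exact mem_nbr.2 ⟨e, he'.1, he'.2.1, hp e he'.1 he'.2.1⟩
  apply card_le_mul_card_image_of_maps_to (f := g)
  · intro Z hZ
    simp only [Ind, mem_filter, mem_powerset] at hZ ⊢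
    obtain ⟨⟨hZX, hZi⟩, hvZ, -⟩ := hZ
    refine ⟨⟨?_, ?_⟩, mem_insert_self _ _⟩
    · exact insert_subset hvX (sdiff_subset.trans hZX)
    · intro f hf hfs
      have hvf : v ∈ f := by
        by_contra hvf
        refine hZi f hf (fun x hx => ?_)
        rcases mem_insert.1 (hfs hx) with rfl | h'
        · exact absurd hx hvf
        · exact (mem_sdiff.1 h').1
      have hfe : ∀ x ∈ f.erase v, x ∈ Z \ (avail E v Z).image p := by
        intro x hx
        rcases mem_insert.1 (hfs (mem_of_mem_erase hx)) with rfl | h'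
        · exact absurd rfl (mem_erase.1 hx).1
        · exact h'
      have hfa : f ∈ avail E v Z := by
        refine mem_filter.2 ⟨hf, hvf, fun u hu f' hf' hfs' => hZi f' hf' ?_⟩
        rwa [insert_eq_of_mem (mem_sdiff.1 (hfe u hu)).1] at hfs'
      exact (mem_sdiff.1 (hfe _ (hp f hf hvf))).2 (mem_image_of_mem _ hfa)
  · intro Z2 hZ2
    by_cases hne : ((((Ind X E).filter (fun Z => v ∉ Z ∧ (avail E v Z).card < K))).filter
        (fun Z => g Z = Z2)).Nonempty
    swap
    · rw [not_nonempty_iff_eq_empty.1 hne]; simp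
    obtain ⟨Z0, hZ0⟩ := hne
    have key : ∀ Z ∈ (((Ind X E).filter (fun Z => v ∉ Z ∧ (avail E v Z).card < K))).filter
        (fun Z => g Z = Z2), avail E v Z = avail E v Z0 := by
      have aux : ∀ Z ∈ (((Ind X E).filter (fun Z => v ∉ Z ∧ (avail E v Z).card < K))).filter
        (fun Z => g Z = Z2), Z \ nbr E v = (Z2.erase v) \ nbr E v := by
        intro Z hZ
        simp only [Ind, mem_filter, mem_powerset] at hZ
        obtain ⟨⟨⟨hZX, hZi⟩, hvZ, -⟩, rfl⟩ := hZ
        ext x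
        simp only [hg, mem_sdiff, mem_erase, mem_insert]
        constructor
        · rintro ⟨hx, hxn⟩
          exact ⟨⟨fun h => hvZ (h ▸ hx), Or.inr ⟨hx, fun h => hxn (hUn Z h)⟩⟩, hxn⟩
        · rintro ⟨⟨hxv, h | h⟩, hxn⟩
          · exact absurd h hxv
          · exact ⟨h.1, hxn⟩
      intro Z hZ
      have e1 := (aux Z hZ).trans (aux Z0 hZ0).symm
      simp only [Ind, mem_filter, mem_powerset] at hZ hZ0
      exact avail_congr h2 hZ.1.1.2 hZ.1.2.1 hZ0.1.1.2 hZ0.1.2.1 e1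
    have hcard : ((avail E v Z0).image p).powerset.card ≤ 2 ^ K := by
      rw [card_powerset]
      refine Nat.pow_le_pow_right (by norm_num) (card_image_le.trans ?_)
      simp only [mem_filter] at hZ0
      exact hZ0.1.2.2.le
    refine le_trans (card_le_card_of_injOn (fun Z => Z ∩ (avail E v Z0).image p) ?_ ?_) hcard
    · intro Z hZ
      exact mem_coe.2 (mem_powerset.2 inter_subset_right)
    · intro Z hZ Z' hZ' hEq
      have k1 := key Z hZ
      have k2 := key Z' hZ'
      simp only [coe_filter, mem_filter, Set.mem_ofPred_eq] at hZ hZ'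
      have g1 := hZ.2
      have g2 := hZ'.2
      simp only [hg, k1, k2] at g1 g2
      have hs : Z \ (avail E v Z0).image p = Z' \ (avail E v Z0).image p := by
        have := congrArg (fun S => S.erase v) (g1.trans g2.symm)
        rwa [erase_insert, erase_insert] at this
        · exact fun h => hZ'.1.2.1 (mem_sdiff.1 h).1
        · exact fun h => hZ.1.2.1 (mem_sdiff.1 h).1
      simp only at hEq
      rw [← sdiff_union_inter Z ((avail E v Z0).image p), hs, hEq, sdiff_union_inter]

lemma many_avail_fixed {X : Finset V} {E : Finset (Finset V)} {v : V}
    (hE : ∀ e ∈ E, e.card = 6) (hEX : ∀ e ∈ E, e ⊆ X)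
    (h2 : ∀ f ∈ E, v ∉ f → ∀ u₁ ∈ f, ∀ u₂ ∈ f, u₁ ∈ nbr E v → u₂ ∈ nbr E v → u₁ = u₂)
    (J : Finset (Finset V)) (hJ : J.Nonempty) :
    ((Ind X E).filter (fun Z => v ∉ Z ∧ avail E v Z = J)).card
      ≤ 64 * ((Ind X E).filter (fun Z => (v ∉ Z ∧ avail E v Z = J) ∧
        J.card ≤ 64 * wt E Z v)).card := by
  set A := (Ind X E).filter (fun Z => v ∉ Z ∧ avail E v Z = J) with hA
  by_cases hAe : A.Nonempty
  swap
  · rw [not_nonempty_iff_eq_empty.1 hAe]; simp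
  have hJE : ∀ e ∈ J, e ∈ E ∧ v ∈ e ∧ e.erase v ⊆ nbr E v := by
    obtain ⟨Z, hZ⟩ := hAe
    have := (mem_filter.1 hZ).2.2
    intro e he
    rw [← this] at he
    have he := mem_filter.1 he
    exact ⟨he.1, he.2.1, fun x hx => mem_nbr.2 ⟨e, he.1, he.2.1, hx⟩⟩
  have step : ∀ e ∈ J, A.card ≤ 32 * (A.filter (fun Z => e.erase v ⊆ Z)).card := by
    intro e he
    obtain ⟨heE, hve, hen⟩ := hJE e he
    apply card_le_mul_card_image_of_maps_to (f := fun Z => Z ∪ e.erase v)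
    · intro Z hZ
      have hZ' := hZ
      simp only [hA, Ind, mem_filter, mem_powerset] at hZ ⊢
      obtain ⟨⟨hZX, hZi⟩, hvZ, hav⟩ := hZ
      have hvn : v ∉ Z ∪ e.erase v := by
        simp [hvZ]
      have hi : ∀ f ∈ E, ¬ f ⊆ Z ∪ e.erase v := by
        intro f hf hfs
        have hvf : v ∉ f := fun h => hvn (hfs h)
        have hea : e ∈ avail E v Z := hav ▸ he
        by_cases hx : ∃ x ∈ f, x ∈ e.erase v
        · obtain ⟨x, hxf, hxe⟩ := hx
          refine (mem_filter.1 hea).2.2 x hxe f hf (fun y hy => ?_)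
          rcases mem_union.1 (hfs hy) with h | h
          · exact mem_insert_of_mem h
          · rw [h2 f hf hvf y hy x hxf (hen h) (hen hxe)]; exact mem_insert_self _ _
        · push Not at hx
          refine hZi f hf (fun y hy => ?_)
          rcases mem_union.1 (hfs hy) with h | h
          · exact h
          · exact absurd h (hx y hy)
      refine ⟨⟨⟨union_subset hZX ((erase_subset _ _).trans (hEX e heE)), hi⟩, hvn, ?_⟩,
        subset_union_right⟩
      rw [← hav]
      refine avail_congr h2 hi hvn hZi hvZ ?_
      rw [union_sdiff_distrib, sdiff_eq_empty_iff_subset.2 hen, union_empty]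
    · intro Z1 hZ1
      have hc : (e.erase v).powerset.card ≤ 32 := by
        rw [card_powerset, card_erase_of_mem hve, hE e heE]; norm_num
      refine le_trans (card_le_card_of_injOn (fun Z => Z ∩ e.erase v) ?_ ?_) hc
      · intro Z hZ
        exact mem_coe.2 (mem_powerset.2 inter_subset_right)
      · intro Z hZ Z' hZ' hEq
        simp only [coe_filter, Set.mem_ofPred_eq] at hZ hZ'
        have hs : Z \ e.erase v = Z' \ e.erase v := by
          have := congrArg (fun S => S \ e.erase v) (hZ.2.trans hZ'.2.symm)
          simpa only [union_sdiff_right] using this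
        simp only at hEq
        rw [← sdiff_union_inter Z (e.erase v), hs, hEq, sdiff_union_inter]
  have hsum : J.card * A.card ≤ 32 * ∑ Z ∈ A, (J.filter (fun e => e.erase v ⊆ Z)).card := by
    calc J.card * A.card = ∑ e ∈ J, A.card := by rw [sum_const, smul_eq_mul]
      _ ≤ ∑ e ∈ J, 32 * (A.filter (fun Z => e.erase v ⊆ Z)).card := sum_le_sum step
      _ = 32 * ∑ Z ∈ A, (J.filter (fun e => e.erase v ⊆ Z)).card := by
          rw [← mul_sum]
          congr 1
          exact sum_card_bipartiteAbove_eq_sum_card_bipartiteBelow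
            (fun (e : Finset V) (Z : Finset V) => e.erase v ⊆ Z)
  have hwt : ∀ Z, (J.filter (fun e => e.erase v ⊆ Z)).card ≤ wt E Z v := by
    intro Z
    apply card_le_card
    intro e he
    have he := mem_filter.1 he
    exact mem_filter.2 ⟨(hJE e he.1).1, (hJE e he.1).2.1, he.2⟩
  set B := A.filter (fun Z => J.card ≤ 64 * wt E Z v) with hB
  have hBe : ((Ind X E).filter (fun Z => (v ∉ Z ∧ avail E v Z = J) ∧
        J.card ≤ 64 * wt E Z v)) = B := by
    rw [hB, hA, filter_filter]
  rw [hBe]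
  have hup : 64 * ∑ Z ∈ A, (J.filter (fun e => e.erase v ⊆ Z)).card
      ≤ 64 * J.card * B.card + J.card * A.card := by
    have h1 : ∀ Z ∈ A, 64 * (J.filter (fun e => e.erase v ⊆ Z)).card
        ≤ (if J.card ≤ 64 * wt E Z v then 64 * J.card else 0) + J.card := by
      intro Z _
      have := hwt Z
      have h3 : (J.filter (fun e => e.erase v ⊆ Z)).card ≤ J.card := card_filter_le _ _
      split_ifs <;> omega
    rw [mul_sum]
    refine (sum_le_sum h1).trans ?_
    rw [sum_add_distrib, ← sum_filter, sum_const, sum_const, smul_eq_mul, smul_eq_mul, ← hB]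
    apply le_of_eq; ring
  have hJp : 0 < J.card := card_pos.2 hJ
  have : J.card * A.card ≤ J.card * (64 * B.card) := by nlinarith
  exact Nat.le_of_mul_le_mul_left this hJp

lemma shearer_vertex {X : Finset V} {E : Finset (Finset V)} {v : V}
    (hE : ∀ e ∈ E, e.card = 6) (hEX : ∀ e ∈ E, e ⊆ X) (hvX : v ∈ X)
    (h2 : ∀ f ∈ E, v ∉ f → ∀ u₁ ∈ f, ∀ u₂ ∈ f, u₁ ∈ nbr E v → u₂ ∈ nbr E v → u₁ = u₂)
    (K : ℕ) (hK : 0 < K) :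
    (Ind X E).card ≤ (2 ^ K + 1) * ((Ind X E).filter (fun Z => v ∈ Z)).card
      + 64 * ((Ind X E).filter (fun Z => K ≤ 64 * wt E Z v)).card := by
  have h1 := few_avail (X := X) hE hvX h2 K
  have h3 : ((Ind X E).filter (fun Z => v ∉ Z ∧ K ≤ (avail E v Z).card)).card
      ≤ 64 * ((Ind X E).filter (fun Z => K ≤ 64 * wt E Z v)).card := by
    set A := (Ind X E).filter (fun Z => v ∉ Z ∧ K ≤ (avail E v Z).card) with hA
    set B := (Ind X E).filter (fun Z => (v ∉ Z ∧ K ≤ (avail E v Z).card) ∧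
      (avail E v Z).card ≤ 64 * wt E Z v) with hB
    have hBle : B.card ≤ ((Ind X E).filter (fun Z => K ≤ 64 * wt E Z v)).card := by
      apply card_le_card
      intro Z hZ
      simp only [hB, mem_filter] at hZ ⊢
      exact ⟨hZ.1, hZ.2.1.2.trans hZ.2.2⟩
    refine le_trans ?_ (Nat.mul_le_mul_left 64 hBle)
    have e1 : A.card = ∑ J ∈ E.powerset, (A.filter (fun Z => avail E v Z = J)).card :=
      card_eq_sum_card_fiberwise (fun Z _ => mem_coe.2 (mem_powerset.2 (filter_subset _ _)))
    have e2 : B.card = ∑ J ∈ E.powerset, (B.filter (fun Z => avail E v Z = J)).card :=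
      card_eq_sum_card_fiberwise (fun Z _ => mem_coe.2 (mem_powerset.2 (filter_subset _ _)))
    rw [e1, e2, mul_sum]
    refine sum_le_sum (fun J _ => ?_)
    by_cases hJ : K ≤ J.card
    · have := many_avail_fixed (X := X) hE hEX h2 J (card_pos.1 (hK.trans_le hJ))
      refine le_trans (card_le_card ?_) (this.trans (Nat.mul_le_mul_left 64 (card_le_card ?_)))
      · intro Z hZ
        simp only [hA, mem_filter] at hZ ⊢
        exact ⟨hZ.1.1, hZ.1.2.1, hZ.2⟩
      · intro Z hZ
        simp only [hB, mem_filter] at hZ ⊢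
        obtain ⟨a, ⟨b, rfl⟩, d⟩ := hZ
        exact ⟨⟨a, ⟨b, hJ⟩, d⟩, rfl⟩
    · have : A.filter (fun Z => avail E v Z = J) = ∅ := by
        apply filter_eq_empty_iff.2
        rintro Z hZ rfl
        exact hJ (mem_filter.1 hZ).2.2
      rw [this]; simp
  have h4 : (Ind X E).card ≤ ((Ind X E).filter (fun Z => v ∈ Z)).card
      + (((Ind X E).filter (fun Z => v ∉ Z ∧ (avail E v Z).card < K)).card
      + ((Ind X E).filter (fun Z => v ∉ Z ∧ K ≤ (avail E v Z).card)).card) := by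
    refine le_trans (card_le_card ?_) ((card_union_le _ _).trans
      (Nat.add_le_add_left (card_union_le _ _) _))
    intro Z hZ
    simp only [mem_union, mem_filter]
    by_cases hv : v ∈ Z
    · exact Or.inl ⟨hZ, hv⟩
    · rcases lt_or_ge (avail E v Z).card K with h | h
      · exact Or.inr (Or.inl ⟨hZ, hv, h⟩)
      · exact Or.inr (Or.inr ⟨hZ, hv, h⟩)
  linarith [add_mul (2 ^ K) 1 ((Ind X E).filter (fun Z => v ∈ Z)).card]

/-- Shearer-type argument: if every independent set is small, and small sets block few vertices,
then `X` is small. -/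
lemma shearer {X : Finset V} {E : Finset (Finset V)}
    (hE : ∀ e ∈ E, e.card = 6) (hEX : ∀ e ∈ E, e ⊆ X)
    (h2 : ∀ v, ∀ f ∈ E, v ∉ f → ∀ u₁ ∈ f, ∀ u₂ ∈ f,
      u₁ ∈ nbr E v → u₂ ∈ nbr E v → u₁ = u₂)
    (K n : ℕ) (hK : 0 < K) (hn : ∀ Z ∈ Ind X E, Z.card < n)
    (hB : ∀ Z ∈ Ind X E, 128 * (X.filter (fun v => K ≤ 64 * wt E Z v)).card ≤ X.card) :
    X.card ≤ 2 * (2 ^ K + 1) * n := by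
  have hpos : 0 < (Ind X E).card := by
    refine card_pos.2 ⟨∅, mem_filter.2 ⟨mem_powerset.2 (empty_subset _), fun e he h => ?_⟩⟩
    have := hE e he
    rw [subset_empty.1 h] at this
    simp at this
  have h1 : X.card * (Ind X E).card ≤ (2 ^ K + 1) * ∑ Z ∈ Ind X E, Z.card
      + 64 * ∑ Z ∈ Ind X E, (X.filter (fun v => K ≤ 64 * wt E Z v)).card := by
    calc X.card * (Ind X E).card = ∑ v ∈ X, (Ind X E).card := by rw [sum_const, smul_eq_mul]
      _ ≤ ∑ v ∈ X, ((2 ^ K + 1) * ((Ind X E).filter (fun Z => v ∈ Z)).card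
      + 64 * ((Ind X E).filter (fun Z => K ≤ 64 * wt E Z v)).card) :=
          sum_le_sum (fun v hv => shearer_vertex hE hEX hv (h2 v) K hK)
      _ = _ := by
          rw [sum_add_distrib, ← mul_sum, ← mul_sum]
          congr 2
          · refine (sum_card_bipartiteAbove_eq_sum_card_bipartiteBelow
              (fun (v : V) (Z : Finset V) => v ∈ Z) (s := X) (t := Ind X E)).trans ?_
            refine sum_congr rfl (fun Z hZ => ?_)
            have : Z ⊆ X := mem_powerset.1 (mem_filter.1 hZ).1
            congr 1
            ext x
            simp only [bipartiteBelow, mem_filter]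
            exact ⟨fun h => h.2, fun h => ⟨this h, h⟩⟩
          · exact sum_card_bipartiteAbove_eq_sum_card_bipartiteBelow
              (fun (v : V) (Z : Finset V) => K ≤ 64 * wt E Z v) (s := X) (t := Ind X E)
  have h3 : ∑ Z ∈ Ind X E, Z.card ≤ (Ind X E).card * n := by
    rw [← smul_eq_mul]; exact sum_le_card_nsmul _ _ _ (fun Z hZ => (hn Z hZ).le)
  have h4 : 128 * ∑ Z ∈ Ind X E, (X.filter (fun v => K ≤ 64 * wt E Z v)).card
      ≤ (Ind X E).card * X.card := by
    rw [mul_sum, ← smul_eq_mul (Ind X E).card]; exact sum_le_card_nsmul _ _ _ hB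
  have h5 : (Ind X E).card * X.card ≤ (Ind X E).card * (2 * (2 ^ K + 1) * n) := by
    have := Nat.mul_le_mul_left (2 ^ K + 1) h3
    nlinarith
  exact Nat.le_of_mul_le_mul_left h5 hpos

end Shearer
end MRProof


namespace MRProof
open Finset

section Sampling
variable {V : Type*} [DecidableEq V] [Fintype V]

/-- `U` together with all vertices completing a 5-subset of `U` to an edge. -/
def cmpl (E : Finset (Finset V)) (U : Finset V) : Finset V :=
  U ∪ univ.filter (fun v => ∃ T ∈ U.powersetCard 5, v ∉ T ∧ insert v T ∈ E)

lemma cmpl_mono (E : Finset (Finset V)) {U U' : Finset V} (h : U ⊆ U') :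
    cmpl E U ⊆ cmpl E U' := by
  refine union_subset_union h (fun v hv => ?_)
  simp only [mem_filter, mem_univ, true_and, mem_powersetCard] at hv ⊢
  obtain ⟨T, ⟨hT, hc⟩, h'⟩ := hv
  exact ⟨T, ⟨hT.trans h, hc⟩, h'⟩

lemma cmpl_card {E : Finset (Finset V)} {C : ℕ}
    (hC : ∀ T : Finset V, T.card = 5 →
      (univ.filter (fun v => v ∉ T ∧ insert v T ∈ E)).card ≤ C) (U : Finset V) (s : ℕ)
    (hU : U.card ≤ s) : (cmpl E U).card ≤ s + 2 ^ s * C := by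
  refine (card_union_le _ _).trans (Nat.add_le_add hU ?_)
  have h1 : univ.filter (fun v => ∃ T ∈ U.powersetCard 5, v ∉ T ∧ insert v T ∈ E)
      ⊆ (U.powersetCard 5).biUnion (fun T => univ.filter (fun v => v ∉ T ∧ insert v T ∈ E)) := by
    intro v hv
    simpa using hv
  refine (card_le_card h1).trans ((card_biUnion_le_card_mul _ _ C ?_).trans ?_)
  · intro T hT
    exact hC T (mem_powersetCard.1 hT).2
  · refine Nat.mul_le_mul_right _ ?_
    calc (U.powersetCard 5).card ≤ U.powerset.card := card_le_card (fun T hT => mem_powerset.2 (mem_powersetCard.1 hT).1)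
      _ = 2 ^ U.card := card_powerset _
      _ ≤ 2 ^ s := Nat.pow_le_pow_right (by norm_num) hU

lemma count_le {ι : Type*} [Fintype ι] [DecidableEq ι] (S : Finset (ι → V)) (A : Finset ι) (D : ℕ)
    (cand : (ι → V) → Finset V) (hc : ∀ f, (cand f).card ≤ D)
    (hcongr : ∀ f g : ι → V, (∀ i, i ∉ A → f i = g i) → cand f = cand g)
    (hS : ∀ f ∈ S, ∀ i ∈ A, f i ∈ cand f) :
    S.card * Fintype.card V ^ A.card ≤ D ^ A.card * Fintype.card V ^ Fintype.card ι := by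
  have h1 : S.card ≤ D ^ A.card * (univ : Finset ({i // i ∉ A} → V)).card := by
    apply card_le_mul_card_image_of_maps_to (f := fun f (i : {i // i ∉ A}) => f i)
    · intro _ _; exact mem_univ _
    · intro h _
      by_cases hne : (S.filter (fun f => (fun (i : {i // i ∉ A}) => f i) = h)).Nonempty
      swap
      · rw [not_nonempty_iff_eq_empty.1 hne]; simp
      obtain ⟨f0, hf0⟩ := hne
      have hcd : (Fintype.piFinset (fun _ : {i // i ∈ A} => cand f0)).card ≤ D ^ A.card := by
        rw [Fintype.card_piFinset, prod_const]
        simp only [card_univ, Fintype.card_coe]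
        exact Nat.pow_le_pow_left (hc f0) _
      refine le_trans (card_le_card_of_injOn (fun f (i : {i // i ∈ A}) => f i) ?_ ?_) hcd
      · intro f hf
        rw [mem_coe, mem_filter] at hf
        rw [mem_filter] at hf0
        have : cand f = cand f0 := hcongr _ _ (fun i hi =>
          congrFun (hf.2.trans hf0.2.symm) ⟨i, hi⟩)
        refine mem_coe.2 (Fintype.mem_piFinset.2 (fun i => ?_))
        rw [← this]
        exact hS f hf.1 i i.2
      · intro f hf g hg hfg
        rw [mem_coe, mem_filter] at hf hg
        funext i
        by_cases hi : i ∈ A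
        · exact congrFun hfg ⟨i, hi⟩
        · exact congrFun (hf.2.trans hg.2.symm) ⟨i, hi⟩
  have h2 : (univ : Finset ({i // i ∉ A} → V)).card
      = Fintype.card V ^ (Fintype.card ι - A.card) := by
    rw [card_univ, Fintype.card_fun]
    congr 1
    rw [Fintype.card_subtype_compl, Fintype.card_coe]
  rw [h2] at h1
  calc S.card * Fintype.card V ^ A.card
      ≤ D ^ A.card * Fintype.card V ^ (Fintype.card ι - A.card) * Fintype.card V ^ A.card :=
        Nat.mul_le_mul_right _ h1
    _ = D ^ A.card * Fintype.card V ^ Fintype.card ι := by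
        rw [mul_assoc, ← pow_add, Nat.sub_add_cancel (card_le_univ A)]

/-- crowding events among the sampled indices. -/
def ev (E : Finset (Finset V)) {m : ℕ} (r s : ℕ) (f : Fin m → V) :
    Finset (Finset (Fin m) × Finset (Fin m)) :=
  ((powersetCard r univ) ×ˢ (powersetCard s univ)).filter
    (fun p => Disjoint p.1 p.2 ∧ ∀ i ∈ p.1, f i ∈ cmpl E (p.2.image f))

lemma ev_sum {E : Finset (Finset V)} {C : ℕ}
    (hC : ∀ T : Finset V, T.card = 5 →
      (univ.filter (fun v => v ∉ T ∧ insert v T ∈ E)).card ≤ C) (m r s D : ℕ)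
    (hD : s + 2 ^ s * C ≤ D) :
    (∑ f : Fin m → V, (ev E r s f).card) * Fintype.card V ^ r
      ≤ m ^ (r + s) * D ^ r * Fintype.card V ^ m := by
  have h0 : ∑ f : Fin m → V, (ev E r s f).card
      = ∑ p ∈ (powersetCard r (univ : Finset (Fin m))) ×ˢ (powersetCard s univ),
        ((univ : Finset (Fin m → V)).filter (fun f => Disjoint p.1 p.2 ∧
          ∀ i ∈ p.1, f i ∈ cmpl E (p.2.image f))).card :=
    sum_card_bipartiteAbove_eq_sum_card_bipartiteBelow
      (fun (f : Fin m → V) (p : Finset (Fin m) × Finset (Fin m)) => Disjoint p.1 p.2 ∧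
          ∀ i ∈ p.1, f i ∈ cmpl E (p.2.image f))
  rw [h0, sum_mul]
  have h1 : ∀ p ∈ (powersetCard r (univ : Finset (Fin m))) ×ˢ (powersetCard s univ),
      ((univ : Finset (Fin m → V)).filter (fun f => Disjoint p.1 p.2 ∧
          ∀ i ∈ p.1, f i ∈ cmpl E (p.2.image f))).card * Fintype.card V ^ r
        ≤ D ^ r * Fintype.card V ^ m := by
    rintro ⟨A, R⟩ hp
    simp only [mem_product, mem_powersetCard, subset_univ, true_and] at hp
    obtain ⟨hA, hR⟩ := hp
    by_cases hd : Disjoint A R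
    · have := count_le ((univ : Finset (Fin m → V)).filter (fun f => Disjoint A R ∧
          ∀ i ∈ A, f i ∈ cmpl E (R.image f))) A D (fun f => cmpl E (R.image f))
          (fun f => (cmpl_card hC _ s (card_image_le.trans hR.le)).trans hD)
          (fun f g h => by
            have : R.image f = R.image g :=
              image_congr (fun i hi => h i (disjoint_right.1 hd hi))
            simp only [this])
          (fun f hf i hi => (mem_filter.1 hf).2.2 i hi)
      rw [hA, Fintype.card_fin] at this
      exact this
    · simp [hd]
  refine (sum_le_card_nsmul _ _ _ h1).trans ?_
  rw [smul_eq_mul, card_product, card_powersetCard, card_powersetCard, card_univ, Fintype.card_fin,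
    pow_add, mul_assoc (m ^ r * m ^ s)]
  exact Nat.mul_le_mul_right _ (Nat.mul_le_mul (Nat.choose_le_pow _ _) (Nat.choose_le_pow _ _))

lemma fail_count (B : Finset V → Finset V) (n m L M : ℕ) (hm : m = 512 * L) (hL : 0 < L)
    (W : ℕ) (hW0 : 0 < W) (hW : ∀ L : ℕ, 4 ^ (512 * L) = W ^ L) (hM : M = W * 4)
    (hB : ∀ Z : Finset V, Z.card ≤ n → M * (B Z).card ≤ Fintype.card V)
    (hq : 0 < Fintype.card V) (S : Finset (Fin m → V))
    (hS : ∀ f ∈ S, ∃ I J : Finset (Fin m), I.card ≤ n ∧ Disjoint I J ∧ J.card = L ∧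
      ∀ j ∈ J, f j ∈ B (I.image f)) :
    4 * S.card ≤ Fintype.card V ^ m := by
  classical
  set q := Fintype.card V with hqdef
  have hM0 : 0 < M := by rw [hM]; positivity
  set P := (univ : Finset (Finset (Fin m) × Finset (Fin m))).filter
    (fun p => p.1.card ≤ n ∧ Disjoint p.1 p.2 ∧ p.2.card = L) with hP
  have h1 : S ⊆ P.biUnion (fun p => (univ : Finset (Fin m → V)).filter
      (fun f => ∀ j ∈ p.2, f j ∈ B (p.1.image f))) := by
    intro f hf
    obtain ⟨I, J, a, b, c, d⟩ := hS f hf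
    rw [mem_biUnion]
    exact ⟨(I, J), mem_filter.2 ⟨mem_univ _, a, b, c⟩, mem_filter.2 ⟨mem_univ _, d⟩⟩
  have h2 : ∀ p ∈ P, M ^ L * ((univ : Finset (Fin m → V)).filter
      (fun f => ∀ j ∈ p.2, f j ∈ B (p.1.image f))).card ≤ q ^ m := by
    rintro ⟨I, J⟩ hp
    obtain ⟨-, hI, hd, hJ⟩ := mem_filter.1 hp
    simp only at hI hd hJ ⊢
    have := count_le ((univ : Finset (Fin m → V)).filter
      (fun f => ∀ j ∈ J, f j ∈ B (I.image f))) J (q / M) (fun f => B (I.image f))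
      (fun f => by
        rw [Nat.le_div_iff_mul_le hM0, mul_comm]
        exact hB _ (card_image_le.trans hI))
      (fun f g h => by
        have : I.image f = I.image g :=
          image_congr (fun i hi => h i (disjoint_left.1 hd hi))
        simp only [this])
      (fun f hf i hi => (mem_filter.1 hf).2 i hi)
    rw [hJ, Fintype.card_fin] at this
    have hqL : 0 < q ^ L := by positivity
    refine Nat.le_of_mul_le_mul_right ?_ hqL
    calc M ^ L * ((univ : Finset (Fin m → V)).filter
          (fun f => ∀ j ∈ J, f j ∈ B (I.image f))).card * q ^ L
        ≤ M ^ L * ((q / M) ^ L * q ^ m) := by rw [mul_assoc]; exact Nat.mul_le_mul_left _ this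
      _ = (M * (q / M)) ^ L * q ^ m := by rw [mul_pow, mul_assoc]
      _ ≤ q ^ L * q ^ m := Nat.mul_le_mul_right _ (Nat.pow_le_pow_left (Nat.mul_div_le _ _) _)
      _ = q ^ m * q ^ L := mul_comm _ _
  have hPc : P.card ≤ W ^ L := by
    refine (card_le_univ _).trans (le_of_eq ?_)
    rw [Fintype.card_prod, Fintype.card_finset, Fintype.card_fin, ← mul_pow, ← hW, hm,
      show (2 * 2 : ℕ) = 4 from rfl]
  have h3 : M ^ L * S.card ≤ W ^ L * q ^ m := by
    calc M ^ L * S.card ≤ M ^ L * ∑ p ∈ P, ((univ : Finset (Fin m → V)).filter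
      (fun f => ∀ j ∈ p.2, f j ∈ B (p.1.image f))).card :=
          Nat.mul_le_mul_left _ ((card_le_card h1).trans card_biUnion_le)
      _ = ∑ p ∈ P, M ^ L * ((univ : Finset (Fin m → V)).filter
      (fun f => ∀ j ∈ p.2, f j ∈ B (p.1.image f))).card := mul_sum _ _ _
      _ ≤ P.card * q ^ m := by rw [← smul_eq_mul]; exact sum_le_card_nsmul _ _ _ h2
      _ ≤ _ := Nat.mul_le_mul_right _ hPc
  rw [hM, mul_pow, mul_assoc] at h3
  have h4 := Nat.le_of_mul_le_mul_left h3 (by positivity)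
  refine le_trans (Nat.mul_le_mul_right _ ?_) h4
  calc 4 = 4 ^ 1 := rfl
    _ ≤ 4 ^ L := Nat.pow_le_pow_right (by norm_num) hL

lemma exists_sample {E : Finset (Finset V)} {C : ℕ}
    (hC : ∀ T : Finset V, T.card = 5 →
      (univ.filter (fun v => v ∉ T ∧ insert v T ∈ E)).card ≤ C)
    (B : Finset V → Finset V) (n m L M D : ℕ) (hm : m = 512 * L) (hL : 0 < L)
    (W : ℕ) (hW0 : 0 < W) (hW : ∀ L : ℕ, 4 ^ (512 * L) = W ^ L) (hM : M = W * 4) (hD : D = 12 + 2 ^ 12 * C)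
    (hB : ∀ Z : Finset V, Z.card ≤ n → M * (B Z).card ≤ Fintype.card V)
    (hq : 0 < Fintype.card V)
    (a1 : 100 * m * D ≤ Fintype.card V) (a2 : 100 * m ^ 9 * D ^ 2 ≤ Fintype.card V ^ 2)
    (a3 : 100 * m ^ 14 * D ^ 3 ≤ Fintype.card V ^ 3) :
    ∃ X : Finset V, m ≤ 2 * X.card ∧
      (∀ r s : ℕ, (r = 2 ∧ s = 8) ∨ (r = 3 ∧ s = 12) → ∀ P U : Finset V, P ⊆ X → U ⊆ X →
        Disjoint P U → P.card = r → U.card ≤ s → ¬ ∀ v ∈ P, v ∈ cmpl E U) ∧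
      ∀ Z ⊆ X, Z.card ≤ n → (X.filter (fun v => v ∈ B Z)).card ≤ n + L := by
  classical
  set q := Fintype.card V with hqdef
  have hmp : 0 < m := by omega
  set F := (univ : Finset (Fin m → V)).filter (fun f => ∃ I J : Finset (Fin m), I.card ≤ n ∧
    Disjoint I J ∧ J.card = L ∧ ∀ j ∈ J, f j ∈ B (I.image f)) with hF
  have hFc : 4 * F.card ≤ q ^ m :=
    fail_count B n m L M hm hL W hW0 hW hM hB hq F (fun f hf => (mem_filter.1 hf).2)
  have evb : ∀ r s : ℕ, s + 2 ^ s * C ≤ D → 100 * m ^ (r + s) * D ^ r ≤ m * q ^ r →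
      100 * ∑ f : Fin m → V, (ev E r s f).card ≤ m * q ^ m := by
    intro r s hs ha
    have h := ev_sum hC m r s D hs
    have hqr : 0 < q ^ r := by positivity
    refine Nat.le_of_mul_le_mul_right ?_ hqr
    calc 100 * (∑ f : Fin m → V, (ev E r s f).card) * q ^ r
        ≤ 100 * (m ^ (r + s) * D ^ r * q ^ m) := by
          rw [mul_assoc]; exact Nat.mul_le_mul_left _ h
      _ = (100 * m ^ (r + s) * D ^ r) * q ^ m := by ring
      _ ≤ (m * q ^ r) * q ^ m := Nat.mul_le_mul_right _ ha
      _ = m * q ^ m * q ^ r := by ring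
  have b1 := evb 1 1 (by rw [hD]; omega) (by
    calc 100 * m ^ (1 + 1) * D ^ 1 = m * (100 * m * D) := by ring
      _ ≤ m * q := Nat.mul_le_mul_left _ a1
      _ = m * q ^ 1 := by rw [pow_one])
  have b2 := evb 2 8 (by rw [hD]; omega) (by
    calc 100 * m ^ (2 + 8) * D ^ 2 = m * (100 * m ^ 9 * D ^ 2) := by ring
      _ ≤ m * q ^ 2 := Nat.mul_le_mul_left _ a2)
  have b3 := evb 3 12 (by rw [hD]) (by
    calc 100 * m ^ (3 + 12) * D ^ 3 = m * (100 * m ^ 14 * D ^ 3) := by ring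
      _ ≤ m * q ^ 3 := Nat.mul_le_mul_left _ a3)
  have hex : ∃ f ∈ (univ : Finset (Fin m → V)),
      2 * ((ev E 1 1 f).card + 2 * (ev E 2 8 f).card + 3 * (ev E 3 12 f).card
        + m * (if f ∈ F then 1 else 0)) < m := by
    apply exists_lt_of_sum_lt
    simp only [← mul_sum, sum_add_distrib]
    rw [sum_const, card_univ, Fintype.card_fun, Fintype.card_fin, smul_eq_mul, ← hqdef]
    have : ∑ f : Fin m → V, (if f ∈ F then 1 else 0) = F.card := by
      rw [sum_boole]; simp
    rw [this]
    have h5 : 4 * (m * F.card) ≤ m * q ^ m := by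
      calc 4 * (m * F.card) = m * (4 * F.card) := by ring
        _ ≤ _ := Nat.mul_le_mul_left _ hFc
    have h6 : 0 < m * q ^ m := by positivity
    rw [mul_comm (q ^ m) m]
    omega
  obtain ⟨f, -, hf⟩ := hex
  have hfF : f ∉ F := by
    intro h
    rw [if_pos h] at hf
    omega
  rw [if_neg hfF] at hf
  set bad : Finset (Fin m) := (ev E 1 1 f).biUnion Prod.fst ∪ ((ev E 2 8 f).biUnion Prod.fst ∪
    (ev E 3 12 f).biUnion Prod.fst) with hbad
  have hbc : ∀ r s, ((ev E r s f).biUnion Prod.fst).card ≤ (ev E r s f).card * r := by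
    intro r s
    refine card_biUnion_le_card_mul _ _ _ (fun p hp => ?_)
    have := (mem_product.1 (mem_filter.1 hp).1).1
    exact (mem_powersetCard.1 this).2.le
  have hbadc : 2 * bad.card < m := by
    have c1 := hbc 1 1
    have c2 := hbc 2 8
    have c3 := hbc 3 12
    have c4 : bad.card ≤ _ := (card_union_le _ _).trans (Nat.add_le_add_left (card_union_le _ _) _)
    omega
  set X' := univ \ bad with hX'
  have hX'c : X'.card + bad.card = m := by
    rw [hX', card_sdiff_add_card_eq_card (subset_univ _), card_univ, Fintype.card_fin]
  have hev : ∀ r s, (r = 1 ∧ s = 1) ∨ (r = 2 ∧ s = 8) ∨ (r = 3 ∧ s = 12) →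
      ∀ A R : Finset (Fin m), A ⊆ X' → A.card = r → R.card = s → Disjoint A R →
      ¬ ∀ i ∈ A, f i ∈ cmpl E (R.image f) := by
    intro r s hrs A R hA hAc hRc hd h
    have hmem : (A, R) ∈ ev E r s f := by
      refine mem_filter.2 ⟨mem_product.2 ⟨mem_powersetCard.2 ⟨subset_univ _, hAc⟩,
        mem_powersetCard.2 ⟨subset_univ _, hRc⟩⟩, hd, h⟩
    have hr : 0 < r := by omega
    obtain ⟨i, hi⟩ := card_pos.1 (hAc.symm ▸ hr)
    have hib : i ∈ bad := by
      have : i ∈ (ev E r s f).biUnion Prod.fst := mem_biUnion.2 ⟨_, hmem, hi⟩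
      rw [hbad]
      rcases hrs with ⟨rfl, rfl⟩ | ⟨rfl, rfl⟩ | ⟨rfl, rfl⟩
      · exact mem_union_left _ this
      · exact mem_union_right _ (mem_union_left _ this)
      · exact mem_union_right _ (mem_union_right _ this)
    exact (mem_sdiff.1 (hA hi)).2 hib
  have hinj : Set.InjOn f X' := by
    intro i hi j hj hij
    by_contra hne
    refine hev 1 1 (Or.inl ⟨rfl, rfl⟩) {i} {j} (singleton_subset_iff.2 hi) (card_singleton _)
      (card_singleton _) (disjoint_singleton.2 hne) ?_
    intro i' hi'
    rw [mem_singleton.1 hi', hij, image_singleton]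
    exact mem_union_left _ (mem_singleton_self _)
  have pre : ∀ U ⊆ X'.image f, (X'.filter (fun i => f i ∈ U)).image f = U ∧
      (X'.filter (fun i => f i ∈ U)).card = U.card := by
    intro U hU
    have h1 : (X'.filter (fun i => f i ∈ U)).image f = U := by
      ext v
      simp only [mem_image, mem_filter]
      constructor
      · rintro ⟨i, ⟨_, h⟩, rfl⟩; exact h
      · intro hv
        obtain ⟨i, hi, rfl⟩ := mem_image.1 (hU hv)
        exact ⟨i, ⟨hi, hv⟩, rfl⟩
    refine ⟨h1, ?_⟩
    conv_rhs => rw [← h1]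
    exact (card_image_of_injOn (hinj.mono (by
      intro i hi; exact (mem_filter.1 (mem_coe.1 hi)).1))).symm
  refine ⟨X'.image f, ?_, ?_, ?_⟩
  · rw [card_image_of_injOn hinj]; omega
  · intro r s hrs P U hP hU hd hPc hUc h
    obtain ⟨p1, p2⟩ := pre P hP
    obtain ⟨u1, u2⟩ := pre U hU
    set A := X'.filter (fun i => f i ∈ P)
    set R0 := X'.filter (fun i => f i ∈ U)
    have hdis : Disjoint A R0 := by
      rw [disjoint_left]
      intro i hi hi'
      exact disjoint_left.1 hd (mem_filter.1 hi).2 (mem_filter.1 hi').2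
    obtain ⟨R, hR1, hR2, hR3⟩ := exists_subsuperset_card_eq (s := R0) (t := univ \ A) (n := s)
      (fun i hi => mem_sdiff.2 ⟨mem_univ _, disjoint_right.1 hdis hi⟩) (by omega) (by
        have := card_sdiff_add_card_eq_card (subset_univ A)
        rw [card_univ, Fintype.card_fin] at this
        omega)
    refine hev r s (Or.inr hrs) A R (filter_subset _ _) (p2.trans hPc) hR3
      (disjoint_right.2 (fun i hi => (mem_sdiff.1 (hR2 hi)).2)) (fun i hi => ?_)
    refine cmpl_mono E ?_ (h (f i) (mem_filter.1 hi).2)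
    rw [← u1]
    exact image_subset_image hR1
  · intro Z hZ hZn
    obtain ⟨z1, z2⟩ := pre Z hZ
    set I := X'.filter (fun i => f i ∈ Z)
    set J0 := (univ \ I).filter (fun j => f j ∈ B Z) with hJ0
    have hJL : J0.card < L := by
      by_contra hlt
      push Not at hlt
      obtain ⟨J, hJ, hJc⟩ := exists_subset_card_eq hlt
      refine hfF (mem_filter.2 ⟨mem_univ _, I, J, z2.le.trans hZn, ?_, hJc, ?_⟩)
      · exact disjoint_right.2 (fun i hi => (mem_sdiff.1 (mem_filter.1 (hJ hi)).1).2)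
      · intro j hj
        rw [z1]
        exact (mem_filter.1 (hJ hj)).2
    have hsub : (X'.image f).filter (fun v => v ∈ B Z) ⊆ Z ∪ J0.image f := by
      intro v hv
      obtain ⟨hv1, hv2⟩ := mem_filter.1 hv
      obtain ⟨i, hi, rfl⟩ := mem_image.1 hv1
      by_cases hz : f i ∈ Z
      · exact mem_union_left _ hz
      · refine mem_union_right _ (mem_image_of_mem _ (mem_filter.2 ⟨mem_sdiff.2 ⟨mem_univ _, ?_⟩,
          hv2⟩))
        exact fun h => hz (mem_filter.1 h).2
    calc _ ≤ (Z ∪ J0.image f).card := card_le_card hsub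
      _ ≤ Z.card + (J0.image f).card := card_union_le _ _
      _ ≤ n + L := Nat.add_le_add hZn (card_image_le.trans hJL.le)

end Sampling
end MRProof


namespace MRProof
open Finset

section Abstract
variable {V : Type*} [DecidableEq V] [Fintype V]

lemma mem_cmpl_of_edge {E : Finset (Finset V)} {e U : Finset V} {v : V} (he : e ∈ E)
    (hc : e.card = 6) (hv : v ∈ e) (h : e.erase v ⊆ U) : v ∈ cmpl E U := by
  refine mem_union_right _ (mem_filter.2 ⟨mem_univ _, e.erase v, mem_powersetCard.2 ⟨h, ?_⟩,
    notMem_erase _ _, ?_⟩)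
  · rw [card_erase_of_mem hv, hc]
  · rwa [insert_erase hv]

lemma exists_notMem_of_ne {e e' : Finset V} (h : e.card = 6) (h' : e'.card = 6) (hne : e ≠ e') :
    ∃ v ∈ e, v ∉ e' := by
  by_contra hcon
  push Not at hcon
  exact hne (eq_of_subset_of_card_le hcon (by rw [h, h']))

lemma linear_of_unc {E : Finset (Finset V)} {X : Finset V} (hE : ∀ e ∈ E, e.card = 6)
    (hX : ∀ r s : ℕ, (r = 2 ∧ s = 8) ∨ (r = 3 ∧ s = 12) → ∀ P U : Finset V, P ⊆ X → U ⊆ X →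
        Disjoint P U → P.card = r → U.card ≤ s → ¬ ∀ v ∈ P, v ∈ cmpl E U)
    {e e' : Finset V} (he : e ∈ E) (he' : e' ∈ E) (heX : e ⊆ X) (heX' : e' ⊆ X) (hne : e ≠ e') :
    (e ∩ e').card ≤ 1 := by
  by_contra hcon
  obtain ⟨v, hv, hv'⟩ := exists_notMem_of_ne (hE e he) (hE e' he') hne
  obtain ⟨u, hu, hu'⟩ := exists_notMem_of_ne (hE e' he') (hE e he) hne.symm
  have hvu : v ≠ u := fun h => hv' (h ▸ hu)
  have hc := card_union_add_card_inter e e'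
  rw [hE e he, hE e' he'] at hc
  have hPs : ({v, u} : Finset V) ⊆ e ∪ e' := by
    intro x hx
    rcases mem_insert.1 hx with rfl | hx
    · exact mem_union_left _ hv
    · rw [mem_singleton.1 hx]; exact mem_union_right _ hu
  have hP2 : ({v, u} : Finset V).card = 2 := card_pair hvu
  have hUX : e ∪ e' ⊆ X := union_subset heX heX'
  refine hX 2 8 (Or.inl ⟨rfl, rfl⟩) {v, u} ((e ∪ e') \ {v, u}) (hPs.trans hUX)
    (sdiff_subset.trans hUX) disjoint_sdiff hP2 ?_ ?_
  · have := card_sdiff_add_card_eq_card hPs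
    omega
  · intro x hx
    rcases mem_insert.1 hx with rfl | hx
    · refine mem_cmpl_of_edge he (hE e he) hv (fun y hy => ?_)
      have hy := mem_erase.1 hy
      simp only [mem_sdiff, mem_union, mem_insert, mem_singleton, not_or]
      exact ⟨Or.inl hy.2, hy.1, fun h => hu' (h ▸ hy.2)⟩
    · rw [mem_singleton.1 hx]
      refine mem_cmpl_of_edge he' (hE e' he') hu (fun y hy => ?_)
      have hy := mem_erase.1 hy
      simp only [mem_sdiff, mem_union, mem_insert, mem_singleton, not_or]
      exact ⟨Or.inr hy.2, fun h => hv' (h ▸ hy.2), hy.1⟩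

lemma exists_private {e a b : Finset V} (he : e.card = 6) (ha : (e ∩ a).card ≤ 1)
    (hb : (e ∩ b).card ≤ 1) : ∃ p ∈ e, p ∉ a ∧ p ∉ b := by
  by_contra hcon
  push Not at hcon
  have : e ⊆ (e ∩ a) ∪ (e ∩ b) := by
    intro x hx
    by_cases hxa : x ∈ a
    · exact mem_union_left _ (mem_inter.2 ⟨hx, hxa⟩)
    · exact mem_union_right _ (mem_inter.2 ⟨hx, hcon x hx hxa⟩)
  have := (card_le_card this).trans (card_union_le _ _)
  omega

lemma triangle_of_unc {E : Finset (Finset V)} {X : Finset V} (hE : ∀ e ∈ E, e.card = 6)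
    (hX : ∀ r s : ℕ, (r = 2 ∧ s = 8) ∨ (r = 3 ∧ s = 12) → ∀ P U : Finset V, P ⊆ X → U ⊆ X →
        Disjoint P U → P.card = r → U.card ≤ s → ¬ ∀ v ∈ P, v ∈ cmpl E U)
    {a b f : Finset V} (ha : a ∈ E) (hb : b ∈ E) (hf : f ∈ E)
    (haX : a ⊆ X) (hbX : b ⊆ X) (hfX : f ⊆ X) {v u₁ u₂ : V} (hva : v ∈ a) (hvb : v ∈ b)
    (hvf : v ∉ f) (h1a : u₁ ∈ a) (h1f : u₁ ∈ f) (h2b : u₂ ∈ b) (h2f : u₂ ∈ f) : u₁ = u₂ := by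
  by_contra hne
  have lin := fun {e e' : Finset V} (he : e ∈ E) (he' : e' ∈ E) (heX : e ⊆ X) (heX' : e' ⊆ X)
    (h : e ≠ e') => linear_of_unc hE hX he he' heX heX' h
  have hfa : f ≠ a := fun h => hvf (h ▸ hva)
  have hfb : f ≠ b := fun h => hvf (h ▸ hvb)
  have hab : a ≠ b := by
    rintro rfl
    have := lin hf ha hfX haX hfa
    exact hne (card_le_one.1 this u₁ (mem_inter.2 ⟨h1f, h1a⟩) u₂ (mem_inter.2 ⟨h2f, h2b⟩))
  obtain ⟨p, hp, hpb, hpf⟩ := exists_private (hE a ha) (lin ha hb haX hbX hab)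
    (lin ha hf haX hfX hfa.symm)
  obtain ⟨r, hr, hra, hrf⟩ := exists_private (hE b hb) (lin hb ha hbX haX hab.symm)
    (lin hb hf hbX hfX hfb.symm)
  obtain ⟨t, ht, hta, htb⟩ := exists_private (hE f hf) (lin hf ha hfX haX hfa)
    (lin hf hb hfX hbX hfb)
  have hpr : p ≠ r := fun h => hra (h ▸ hp)
  have hpt : p ≠ t := fun h => hta (h ▸ hp)
  have hrt : r ≠ t := fun h => htb (h ▸ hr)
  have hP3 : ({p, r, t} : Finset V).card = 3 := card_eq_three.2 ⟨p, r, t, hpr, hpt, hrt, rfl⟩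
  have hPs : ({p, r, t} : Finset V) ⊆ a ∪ b ∪ f := by
    intro x hx
    simp only [mem_insert, mem_singleton] at hx
    simp only [mem_union]
    rcases hx with rfl | rfl | rfl
    · exact Or.inl (Or.inl hp)
    · exact Or.inl (Or.inr hr)
    · exact Or.inr ht
  have hUX : a ∪ b ∪ f ⊆ X := union_subset (union_subset haX hbX) hfX
  have hcard : (a ∪ b ∪ f).card ≤ 15 := by
    have c1 := card_union_add_card_inter a b
    have c2 := card_union_add_card_inter (a ∪ b) f
    have c3 : 0 < (a ∩ b).card := card_pos.2 ⟨v, mem_inter.2 ⟨hva, hvb⟩⟩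
    have c4 : 1 < ((a ∪ b) ∩ f).card := one_lt_card.2
      ⟨u₁, mem_inter.2 ⟨mem_union_left _ h1a, h1f⟩, u₂, mem_inter.2 ⟨mem_union_right _ h2b, h2f⟩,
        hne⟩
    rw [hE a ha, hE b hb] at c1
    rw [hE f hf] at c2
    omega
  refine hX 3 12 (Or.inr ⟨rfl, rfl⟩) {p, r, t} ((a ∪ b ∪ f) \ {p, r, t}) (hPs.trans hUX)
    (sdiff_subset.trans hUX) disjoint_sdiff hP3 ?_ ?_
  · have := card_sdiff_add_card_eq_card hPs
    omega
  · intro x hx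
    simp only [mem_insert, mem_singleton] at hx
    rcases hx with rfl | rfl | rfl
    · refine mem_cmpl_of_edge ha (hE a ha) hp (fun y hy => ?_)
      have hy := mem_erase.1 hy
      simp only [mem_sdiff, mem_union, mem_insert, mem_singleton, not_or]
      exact ⟨Or.inl (Or.inl hy.2), hy.1, fun h => hra (h ▸ hy.2), fun h => hta (h ▸ hy.2)⟩
    · refine mem_cmpl_of_edge hb (hE b hb) hr (fun y hy => ?_)
      have hy := mem_erase.1 hy
      simp only [mem_sdiff, mem_union, mem_insert, mem_singleton, not_or]
      exact ⟨Or.inl (Or.inr hy.2), fun h => hpb (h ▸ hy.2), hy.1, fun h => htb (h ▸ hy.2)⟩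
    · refine mem_cmpl_of_edge hf (hE f hf) ht (fun y hy => ?_)
      have hy := mem_erase.1 hy
      simp only [mem_sdiff, mem_union, mem_insert, mem_singleton, not_or]
      exact ⟨Or.inr hy.2, fun h => hpf (h ▸ hy.2), fun h => hrf (h ▸ hy.2), hy.1⟩

lemma wt_sum {E : Finset (Finset V)} {C : ℕ} (hE : ∀ e ∈ E, e.card = 6)
    (hC : ∀ T : Finset V, T.card = 5 →
      (univ.filter (fun v => v ∉ T ∧ insert v T ∈ E)).card ≤ C) (Z : Finset V) :
    ∑ v, wt E Z v ≤ C * Z.card ^ 5 := by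
  have h1 : ∀ v, wt E Z v = ((Z.powersetCard 5).filter (fun T => v ∉ T ∧ insert v T ∈ E)).card := by
    intro v
    apply card_bij (fun e _ => e.erase v)
    · intro e he
      obtain ⟨he, hv, hs⟩ := mem_filter.1 he
      refine mem_filter.2 ⟨mem_powersetCard.2 ⟨hs, ?_⟩, notMem_erase _ _, ?_⟩
      · rw [card_erase_of_mem hv, hE e he]
      · rwa [insert_erase hv]
    · intro e he e' he' h
      rw [← insert_erase (mem_filter.1 he).2.1, h, insert_erase (mem_filter.1 he').2.1]
    · intro T hT
      obtain ⟨hT, hv, hi⟩ := mem_filter.1 hT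
      refine ⟨insert v T, mem_filter.2 ⟨hi, mem_insert_self _ _, ?_⟩, erase_insert hv⟩
      rw [erase_insert hv]
      exact (mem_powersetCard.1 hT).1
  have h2 : ∑ v, ((Z.powersetCard 5).filter (fun T => v ∉ T ∧ insert v T ∈ E)).card
      = ∑ T ∈ Z.powersetCard 5, (univ.filter (fun v => v ∉ T ∧ insert v T ∈ E)).card :=
    sum_card_bipartiteAbove_eq_sum_card_bipartiteBelow
      (fun (v : V) (T : Finset V) => v ∉ T ∧ insert v T ∈ E)
  rw [sum_congr rfl (fun v _ => h1 v), h2]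
  refine (sum_le_card_nsmul _ _ C (fun T hT => hC T (mem_powersetCard.1 hT).2)).trans ?_
  rw [smul_eq_mul, card_powersetCard, mul_comm]
  exact Nat.mul_le_mul_left _ (Nat.choose_le_pow _ _)

lemma indep_core {E : Finset (Finset V)} {C : ℕ} (hE : ∀ e ∈ E, e.card = 6)
    (hC : ∀ T : Finset V, T.card = 5 →
      (univ.filter (fun v => v ∉ T ∧ insert v T ∈ E)).card ≤ C)
    (W : ℕ) (hW0 : 0 < W) (hW : ∀ L : ℕ, 4 ^ (512 * L) = W ^ L) (n k T D : ℕ)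
    (hD : D = 12 + 2 ^ 12 * C) (hn : 0 < n) (hk : 5 ≤ k) (hT : T = 4 ^ k) (hTn : T ^ 20 ≤ n)
    (hDT : 100 * D ≤ T)
    (hq : 64 * (C + 1) * (W * 4) * n ^ 5 ≤ k * Fintype.card V) :
    ∃ S : Finset V, S.card = n ∧ ∀ e ∈ E, ¬ e ⊆ S := by
  set q := Fintype.card V with hqdef
  by_contra hcon
  push Not at hcon
  have hTp : 0 < T := by rw [hT]; positivity
  have hkT : k ≤ T := by rw [hT]; exact (Nat.lt_pow_self (by norm_num)).le
  have hnq : n ^ 5 ≤ T * q := by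
    calc n ^ 5 ≤ 64 * (C + 1) * (W * 4) * n ^ 5 := Nat.le_mul_of_pos_left _ (by positivity)
      _ ≤ k * q := hq
      _ ≤ T * q := Nat.mul_le_mul_right _ hkT
  have hq0 : 0 < q := by
    rcases Nat.eq_zero_or_pos q with h | h
    · rw [h, mul_zero] at hnq
      have : 0 < n ^ 5 := by positivity
      omega
    · exact h
  obtain ⟨j, rfl⟩ : ∃ j, k = j + 5 := ⟨k - 5, by omega⟩
  have hT2 : T = 512 * (2 * 4 ^ j) := by rw [hT, pow_add]; ring
  have hmL : n * T = 512 * (n * (2 * 4 ^ j)) := by rw [hT2]; ring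
  have hLp : 0 < n * (2 * 4 ^ j) := by positivity
  have hnL : n ≤ n * (2 * 4 ^ j) := Nat.le_mul_of_pos_right _ (by positivity)
  set B : Finset V → Finset V := fun Z => univ.filter (fun v => j + 5 ≤ 64 * wt E Z v) with hB
  have hBc : ∀ Z : Finset V, Z.card ≤ n → (W * 4) * (B Z).card ≤ q := by
    intro Z hZ
    have h1 : (j + 5) * (B Z).card ≤ 64 * (C * n ^ 5) := by
      calc (j + 5) * (B Z).card = ∑ v ∈ B Z, (j + 5) := by rw [sum_const, smul_eq_mul, mul_comm]
        _ ≤ ∑ v ∈ B Z, 64 * wt E Z v := sum_le_sum (fun v hv => (mem_filter.1 hv).2)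
        _ ≤ ∑ v, 64 * wt E Z v := sum_le_sum_of_subset (subset_univ _)
        _ = 64 * ∑ v, wt E Z v := (mul_sum _ _ _).symm
        _ ≤ 64 * (C * n ^ 5) := Nat.mul_le_mul_left _ ((wt_sum hE hC Z).trans
            (Nat.mul_le_mul_left _ (Nat.pow_le_pow_left hZ _)))
    refine Nat.le_of_mul_le_mul_left ?_ (show 0 < j + 5 by omega)
    calc (j + 5) * (W * 4 * (B Z).card) = (W * 4) * ((j + 5) * (B Z).card) := by ring
      _ ≤ (W * 4) * (64 * (C * n ^ 5)) := Nat.mul_le_mul_left _ h1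
      _ ≤ 64 * (C + 1) * (W * 4) * n ^ 5 := by
          have : 0 ≤ W * 4 * 64 * n ^ 5 := Nat.zero_le _
          nlinarith
      _ ≤ _ := hq
  have hD2 : 100 * D ^ 2 ≤ T ^ 2 := by nlinarith
  have hD3 : 100 * D ^ 3 ≤ T ^ 3 := by
    calc 100 * D ^ 3 ≤ (100 * D) ^ 3 := by rw [mul_pow]; exact Nat.mul_le_mul_right _ (by norm_num)
      _ ≤ T ^ 3 := Nat.pow_le_pow_left hDT _
  have hTn' : ∀ i, i ≤ 20 → T ^ i ≤ n := fun i hi => (Nat.pow_le_pow_right hTp hi).trans hTn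
  have a1 : 100 * (n * T) * D ≤ q := by
    refine Nat.le_of_mul_le_mul_left ?_ hTp
    calc T * (100 * (n * T) * D) = n * T ^ 2 * (100 * D) := by ring
      _ ≤ n * T ^ 2 * T := Nat.mul_le_mul_left _ hDT
      _ = n * T ^ 3 := by ring
      _ ≤ n * n := Nat.mul_le_mul_left _ (hTn' 3 (by norm_num))
      _ = n ^ 2 := by ring
      _ ≤ n ^ 5 := Nat.pow_le_pow_right hn (by norm_num)
      _ ≤ T * q := hnq
  have a2 : 100 * (n * T) ^ 9 * D ^ 2 ≤ q ^ 2 := by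
    refine Nat.le_of_mul_le_mul_left ?_ (show 0 < T ^ 2 by positivity)
    calc T ^ 2 * (100 * (n * T) ^ 9 * D ^ 2) = n ^ 9 * T ^ 11 * (100 * D ^ 2) := by ring
      _ ≤ n ^ 9 * T ^ 11 * T ^ 2 := Nat.mul_le_mul_left _ hD2
      _ = n ^ 9 * T ^ 13 := by ring
      _ ≤ n ^ 9 * n := Nat.mul_le_mul_left _ (hTn' 13 (by norm_num))
      _ = (n ^ 5) ^ 2 := by ring
      _ ≤ (T * q) ^ 2 := Nat.pow_le_pow_left hnq _
      _ = T ^ 2 * q ^ 2 := by ring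
  have a3 : 100 * (n * T) ^ 14 * D ^ 3 ≤ q ^ 3 := by
    refine Nat.le_of_mul_le_mul_left ?_ (show 0 < T ^ 3 by positivity)
    calc T ^ 3 * (100 * (n * T) ^ 14 * D ^ 3) = n ^ 14 * T ^ 17 * (100 * D ^ 3) := by ring
      _ ≤ n ^ 14 * T ^ 17 * T ^ 3 := Nat.mul_le_mul_left _ hD3
      _ = n ^ 14 * T ^ 20 := by ring
      _ ≤ n ^ 14 * n := Nat.mul_le_mul_left _ hTn
      _ = (n ^ 5) ^ 3 := by ring
      _ ≤ (T * q) ^ 3 := Nat.pow_le_pow_left hnq _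
      _ = T ^ 3 * q ^ 3 := by ring
  obtain ⟨X, hXc, hXu, hXB⟩ := exists_sample hC B n (n * T) (n * (2 * 4 ^ j)) (W * 4) D hmL hLp
    W hW0 hW rfl hD hBc hq0 a1 a2 a3
  set E' := E.filter (fun e => e ⊆ X) with hE'
  have hE'E : ∀ e ∈ E', e ∈ E ∧ e ⊆ X := fun e he => mem_filter.1 he
  have hsmall : ∀ Z ∈ Ind X E', Z.card < n := by
    intro Z hZ
    by_contra hlt
    push Not at hlt
    obtain ⟨S, hSZ, hSn⟩ := exists_subset_card_eq hlt
    obtain ⟨e, he, heS⟩ := hcon S hSn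
    obtain ⟨hZX, hZi⟩ := mem_Ind.1 hZ
    have heZ := heS.trans hSZ
    exact hZi e (mem_filter.2 ⟨he, heZ.trans hZX⟩) heZ
  have hfin := shearer (X := X) (E := E') (fun e he => hE e (hE'E e he).1)
    (fun e he => (hE'E e he).2) ?_ (j + 5) n (by omega) hsmall ?_
  · have hp : 1 ≤ 2 ^ j := Nat.one_le_two_pow
    have e4 : (4 : ℕ) ^ j = 2 ^ j * 2 ^ j := by rw [← mul_pow, show (2 * 2 : ℕ) = 4 from rfl]
    have e5 : 2 ^ (j + 5) = 32 * 2 ^ j := by rw [pow_add]; ring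
    rw [hmL, e4] at hXc
    rw [e5] at hfin
    have : n * (512 * (2 * (2 ^ j * 2 ^ j))) ≤ n * (4 * (32 * 2 ^ j + 1)) := by nlinarith
    have := Nat.le_of_mul_le_mul_left this hn
    nlinarith
  · intro v f hf hvf u₁ hu₁ u₂ hu₂ h1 h2
    obtain ⟨a, ha, hva, h1a⟩ := mem_nbr.1 h1
    obtain ⟨b, hb, hvb, h2b⟩ := mem_nbr.1 h2
    exact triangle_of_unc hE hXu (hE'E a ha).1 (hE'E b hb).1 (hE'E f hf).1 (hE'E a ha).2
      (hE'E b hb).2 (hE'E f hf).2 hva hvb hvf (mem_of_mem_erase h1a) hu₁ (mem_of_mem_erase h2b) hu₂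
  · intro Z hZ
    have h1 := hXB Z (mem_Ind.1 hZ).1 (hsmall Z hZ).le
    have h2 : (X.filter (fun v => j + 5 ≤ 64 * wt E' Z v)).card
        ≤ (X.filter (fun v => v ∈ B Z)).card := by
      apply card_le_card
      intro v hv
      obtain ⟨hvX, hv⟩ := mem_filter.1 hv
      refine mem_filter.2 ⟨hvX, mem_filter.2 ⟨mem_univ _, hv.trans (Nat.mul_le_mul_left _ ?_)⟩⟩
      apply card_le_card
      intro e he
      obtain ⟨he, h⟩ := mem_filter.1 he
      exact mem_filter.2 ⟨(hE'E e he).1, h⟩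
    omega

end Abstract

theorem exists_W : ∃ W : ℕ, 0 < W ∧ ∀ L : ℕ, 4 ^ (512 * L) = W ^ L := by
  have key : ∀ a : ℕ, ∃ W : ℕ, 0 < W ∧ ∀ L : ℕ, 4 ^ (a * L) = W ^ L :=
    fun a => ⟨4 ^ a, Nat.pow_pos (by norm_num), fun L => pow_mul _ _ _⟩
  exact key 512

theorem log_le_aux (n k m : ℕ) (hn0 : 0 < n) (hm : m = 40 * k + 40) (hk : 1 ≤ k)
    (h : n ≤ 2 ^ m) : Real.log n ≤ 80 * k := by
  have h1 : Real.log n ≤ m * Real.log 2 := by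
    rw [← Real.log_pow]
    apply Real.log_le_log (Nat.cast_pos.2 hn0)
    have h5 : (n : ℝ) ≤ ((2 ^ m : ℕ) : ℝ) := Nat.cast_le.2 h
    rw [Nat.cast_pow] at h5
    exact h5
  clear h
  have h2 : Real.log 2 ≤ 1 := by linarith [Real.log_two_lt_d9]
  have h3 : (1 : ℝ) ≤ k := Nat.one_le_cast.2 hk
  have h4 : (m : ℝ) * Real.log 2 ≤ m * 1 := mul_le_mul_of_nonneg_left h2 (Nat.cast_nonneg _)
  have h5 : (m : ℝ) = 40 * k + 40 := by rw [hm]; push_cast; ring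
  linarith

theorem log_facts (n K : ℕ) (hn : 2 ^ (40 * K) ≤ n) (hK : 1 ≤ K) : ∃ k : ℕ, K ≤ k ∧
    2 ^ (40 * k) ≤ n ∧ 0 < Real.log n ∧ Real.log n ≤ 80 * k := by
  have hn0 : 0 < n := lt_of_lt_of_le (Nat.pow_pos (by norm_num)) hn
  obtain ⟨k, hk⟩ : ∃ k, k = Nat.log 2 n / 40 := ⟨_, rfl⟩
  have hk1 : K ≤ k := by
    rw [hk, Nat.le_div_iff_mul_le (by norm_num), mul_comm]
    exact Nat.le_log_of_pow_le (by norm_num) hn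
  have hlow : 2 ^ (40 * k) ≤ n := by
    refine le_trans (Nat.pow_le_pow_right (by norm_num) ?_) (Nat.pow_log_le_self 2 hn0.ne')
    rw [hk]; exact Nat.mul_div_le _ _
  have hhigh : n < 2 ^ (40 * k + 40) := by
    refine lt_of_lt_of_le (Nat.lt_pow_succ_log_self (by norm_num : 1 < 2) n)
      (Nat.pow_le_pow_right (by norm_num) ?_)
    omega
  have hlogp : 0 < Real.log n := by
    apply Real.log_pos
    have : 1 < n := lt_of_lt_of_le (Nat.one_lt_two_pow (by omega)) hlow
    exact_mod_cast this
  exact ⟨k, hk1, hlow, hlogp, log_le_aux n k _ hn0 rfl (by omega) hhigh.le⟩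

theorem exists_indep (C : ℕ) : ∃ C₁ : ℝ, 0 < C₁ ∧ ∃ N : ℕ, ∀ n : ℕ, N ≤ n →
    ∀ (V : Type) [DecidableEq V] [Fintype V], C₁ * (n : ℝ) ^ 5 / Real.log n < Fintype.card V →
    ∀ E : Finset (Finset V), (∀ e ∈ E, e.card = 6) →
    (∀ T : Finset V, T.card = 5 → (univ.filter (fun v => v ∉ T ∧ insert v T ∈ E)).card ≤ C) →
    ∃ S : Finset V, S.card = n ∧ ∀ e ∈ E, ¬ e ⊆ S := by
  obtain ⟨W, hW0, hW⟩ := exists_W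
  obtain ⟨D, hD⟩ : ∃ D, D = 12 + 2 ^ 12 * C := ⟨_, rfl⟩
  obtain ⟨M, hM⟩ : ∃ M : ℕ, M = 64 * (C + 1) * (W * 4) := ⟨_, rfl⟩
  have hM0 : 0 < M := by rw [hM]; positivity
  refine ⟨80 * (M : ℝ), by positivity, 2 ^ (40 * (100 * D + 5)), ?_⟩
  intro n hn V _ _ hq E hE hC
  have hn0 : 0 < n := lt_of_lt_of_le (Nat.pow_pos (by norm_num)) hn
  obtain ⟨k, hk1, hlow, hlogp, hlog⟩ := log_facts n _ hn (by omega)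
  have hqn : M * n ^ 5 ≤ k * Fintype.card V := by
    rw [div_lt_iff₀ hlogp] at hq
    have h1 : (Fintype.card V : ℝ) * Real.log n ≤ Fintype.card V * (80 * k) :=
      mul_le_mul_of_nonneg_left hlog (by positivity)
    have h2 : (M : ℝ) * (n : ℝ) ^ 5 ≤ k * Fintype.card V := by
      clear hW hn hlow
      linarith
    exact_mod_cast h2
  rw [hM] at hqn
  refine indep_core hE hC W hW0 hW n k (4 ^ k) D hD hn0 (by omega) rfl ?_ ?_ hqn
  · refine le_trans (le_of_eq ?_) hlow
    rw [show (4 : ℕ) = 2 ^ 2 from rfl, ← pow_mul, ← pow_mul]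
    congr 1; ring
  · exact le_trans (by omega) (Nat.lt_pow_self (by norm_num : 1 < 4)).le

end MRProof


namespace MRProof
open Finset

section Bad

variable {F : Type} [Field F]

/-- the hexagon polynomial. -/
def hexP (x : Fin 6 → F) : F :=
  (x 0 - x 1) * (x 2 - x 3) * (x 4 - x 5) + (x 1 - x 2) * (x 3 - x 4) * (x 5 - x 0)

theorem hexP_rot (x : Fin 6 → F) (i : Fin 6) : hexP (fun j => x (j + i)) = hexP x := by
  have h1 : ∀ y : Fin 6 → F, hexP (fun j => y (j + 1)) = hexP y := by
    intro y
    simp only [hexP]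
    rw [show (0 + 1 : Fin 6) = 1 from rfl, show (1 + 1 : Fin 6) = 2 from rfl,
      show (2 + 1 : Fin 6) = 3 from rfl, show (3 + 1 : Fin 6) = 4 from rfl,
      show (4 + 1 : Fin 6) = 5 from rfl, show (5 + 1 : Fin 6) = 0 from rfl]
    ring
  induction i using Fin.induction with
  | zero => simp
  | succ i ih =>
    rw [← ih, ← h1 (fun j => x (j + i.castSucc))]
    have h2 : ∀ j : Fin 6, j + i.succ = j + 1 + i.castSucc := by
      intro j; rw [← Fin.coeSucc_eq_succ, add_assoc, add_comm 1]
    simp only [h2]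

theorem hexP_unique (x y : Fin 6 → F) (hx : Function.Injective x)
    (h : ∀ i : Fin 6, i ≠ 5 → x i = y i) (hPx : hexP x = 0) (hPy : hexP y = 0) : x 5 = y 5 := by
  have h0 := h 0 (by decide)
  have h1 := h 1 (by decide)
  have h2 := h 2 (by decide)
  have h3 := h 3 (by decide)
  have h4 := h 4 (by decide)
  by_contra hne
  simp only [hexP, ← h0, ← h1, ← h2, ← h3, ← h4] at hPx hPy
  have hc : (x 1 - x 2) * (x 3 - x 4) - (x 0 - x 1) * (x 2 - x 3) = 0 := by
    have : ((x 1 - x 2) * (x 3 - x 4) - (x 0 - x 1) * (x 2 - x 3)) * (x 5 - y 5) = 0 := by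
      linear_combination hPx - hPy
    exact (mul_eq_zero.1 this).resolve_right (sub_ne_zero.2 hne)
  have h6 : (x 0 - x 1) * (x 2 - x 3) * (x 4 - x 0) = 0 := by
    linear_combination hPx - (x 5 - x 0) * hc
  have n1 : x 0 - x 1 ≠ 0 := sub_ne_zero.2 (hx.ne (by decide))
  have n2 : x 2 - x 3 ≠ 0 := sub_ne_zero.2 (hx.ne (by decide))
  have n3 : x 4 - x 0 ≠ 0 := sub_ne_zero.2 (hx.ne (by decide))
  exact mul_ne_zero (mul_ne_zero n1 n2) n3 h6

variable [Fintype F] [DecidableEq F]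

/-- bad 6-sets. -/
def badE (F : Type) [Field F] [Fintype F] [DecidableEq F] : Finset (Finset F) :=
  univ.filter (fun e => ∃ x : Fin 6 → F, Function.Injective x ∧ hexP x = 0 ∧ univ.image x = e)

theorem mem_badE {e : Finset F} : e ∈ badE F ↔
    ∃ x : Fin 6 → F, Function.Injective x ∧ hexP x = 0 ∧ univ.image x = e := by
  simp [badE]

theorem badE_card (e : Finset F) (he : e ∈ badE F) : e.card = 6 := by
  obtain ⟨x, hx, -, rfl⟩ := mem_badE.1 he
  rw [card_image_of_injective _ hx]; simp

theorem badE_codeg (T : Finset F) (hT : T.card = 5) :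
    (univ.filter (fun v => v ∉ T ∧ insert v T ∈ badE F)).card ≤ 5 ^ 6 := by
  have key : ∀ v : F, v ∈ univ.filter (fun v => v ∉ T ∧ insert v T ∈ badE F) →
      ∃ x : Fin 6 → F, Function.Injective x ∧ hexP x = 0 ∧ x 5 = v ∧ ∀ i, i ≠ 5 → x i ∈ T := by
    intro v hv
    obtain ⟨-, hvT, hv⟩ := mem_filter.1 hv
    obtain ⟨x, hx, hP, himg⟩ := mem_badE.1 hv
    have : v ∈ univ.image x := by rw [himg]; exact mem_insert_self _ _
    obtain ⟨i, -, hi⟩ := mem_image.1 this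
    have h5 : x (5 + (i + 1)) = v := by
      rw [← hi]; congr 1
      have h6 : ∀ i : Fin 6, 5 + (i + 1) = i := by decide
      exact h6 i
    have hinj : Function.Injective (fun j => x (j + (i + 1))) :=
      fun a b hab => add_right_cancel (hx hab)
    refine ⟨fun j => x (j + (i + 1)), hinj, by rw [hexP_rot]; exact hP, h5, ?_⟩
    intro j hj
    have hm : x (j + (i + 1)) ∈ insert v T := by
      rw [← himg]; exact mem_image_of_mem _ (mem_univ _)
    refine (mem_insert.1 hm).resolve_left ?_
    intro h
    exact hj (hinj (h.trans h5.symm))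
  have hTn : T.Nonempty := card_pos.1 (by omega)
  obtain ⟨t₀, ht₀⟩ := hTn
  choose! X hXi hXP hX5 hXT using key
  let f : F → (Fin 6 → T) := fun v i => if h : X v i ∈ T then ⟨X v i, h⟩ else ⟨t₀, ht₀⟩
  have hle : (univ.filter (fun v => v ∉ T ∧ insert v T ∈ badE F)).card ≤
      (univ : Finset (Fin 6 → T)).card := by
    refine card_le_card_of_injOn f (fun _ _ => mem_coe.2 (mem_univ _)) ?_
    intro v hv w hw hvw
    have hv' := mem_coe.1 hv
    have hw' := mem_coe.1 hw
    rw [← hX5 v hv', ← hX5 w hw']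
    refine hexP_unique _ _ (hXi v hv') ?_ (hXP v hv') (hXP w hw')
    intro i hi
    have := congrFun hvw i
    simp only [f, dif_pos (hXT v hv' i hi), dif_pos (hXT w hw' i hi)] at this
    exact congrArg Subtype.val this
  refine hle.trans (le_of_eq ?_)
  simp [hT]

end Bad

section Dim

theorem exists_supported {K : Type} [Field K] {ι κ : Type} [Fintype ι] [DecidableEq ι] [Fintype κ]
    (D : Finset ι) (ℓ : κ → (ι → K) →ₗ[K] K) (h : Fintype.card κ < D.card) :
    ∃ c : ι → K, c ≠ 0 ∧ (∀ i, i ∉ D → c i = 0) ∧ ∀ k, ℓ k c = 0 := by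
  let φ : (ι → K) →ₗ[K] (κ ⊕ {i // i ∉ D} → K) :=
    LinearMap.pi (fun s => Sum.elim ℓ (fun i => LinearMap.proj i.1) s)
  have hc : Fintype.card {i // i ∉ D} + D.card = Fintype.card ι := by
    have h1 := Fintype.card_subtype_compl (fun i => i ∈ D)
    have h2 : D.card ≤ Fintype.card ι := card_le_univ D
    rw [Fintype.card_coe] at h1
    omega
  have hk : LinearMap.ker φ ≠ ⊥ := by
    apply LinearMap.ker_ne_bot_of_finrank_lt
    rw [Module.finrank_fintype_fun_eq_card, Module.finrank_fintype_fun_eq_card, Fintype.card_sum]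
    omega
  obtain ⟨c, hcm, hc0⟩ := (Submodule.ne_bot_iff _).1 hk
  have hz : ∀ s, φ c s = 0 := fun s => congrFun (LinearMap.mem_ker.1 hcm) s
  exact ⟨c, hc0, fun i hi => hz (Sum.inr ⟨i, hi⟩), fun k => hz (Sum.inl k)⟩

theorem dim_lemma {n : ℕ} {E : Finset (Fin 4 × Fin n)} (hE : CorrectableForTopology 4 n 1 2 E)
    (U : Finset (Fin 4)) (V : Finset (Fin n)) (hU : U.Nonempty) (hV : 2 ≤ V.card)
    (D : Finset (Fin 4 × Fin n)) (hDE : D ⊆ E) (hD : D ⊆ U ×ˢ V) :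
    D.card + 2 ≤ V.card + 2 * U.card := by
  obtain ⟨K, fK, -, C, ⟨Hc, Hr, rfl⟩, hcor⟩ := hE
  by_contra hlt
  push Not at hlt
  have hUc : 0 < U.card := hU.card_pos
  let colF : Fin n → (Fin 4 × Fin n → K) →ₗ[K] K :=
    fun j => ∑ i, Hc 0 i • LinearMap.proj (i, j)
  let rowF : Fin 4 → Fin 2 → (Fin 4 × Fin n → K) →ₗ[K] K :=
    fun i t => ∑ j, Hr t j • LinearMap.proj (i, j)
  have hcol : ∀ j c, colF j c = ∑ i, Hc 0 i * c (i, j) := by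
    intro j c; simp [colF, LinearMap.sum_apply]
  have hrow : ∀ i t c, rowF i t c = ∑ j, Hr t j * c (i, j) := by
    intro j t c; simp [rowF, LinearMap.sum_apply]
  suffices hs : ∃ c : Fin 4 × Fin n → K, c ≠ 0 ∧ (∀ p, p ∉ D → c p = 0) ∧
      (∀ j, ∑ i, Hc 0 i * c (i, j) = 0) ∧ ∀ i t, ∑ j, Hr t j * c (i, j) = 0 by
    obtain ⟨c, hc0, hcD, h1, h2⟩ := hs
    have := hcor (fun i j => c (i, j)) ⟨?_, ?_⟩ 0 ⟨?_, ?_⟩ ?_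
    · apply hc0
      funext p
      exact congrFun (congrFun this p.1) p.2
    · intro j; funext t
      have ht : t = 0 := Subsingleton.elim _ _
      subst ht
      exact h1 j
    · intro i; funext t
      exact h2 i t
    · intro j; exact Matrix.mulVec_zero _
    · intro j; exact Matrix.mulVec_zero _
    · intro p hp
      exact hcD p (fun h => hp (hDE h))
  have hoffU : ∀ c : Fin 4 × Fin n → K, (∀ p, p ∉ D → c p = 0) → ∀ i j, i ∉ U → c (i, j) = 0 :=
    fun c hc i j hi => hc _ (fun h => hi (mem_product.1 (hD h)).1)
  have hoffV : ∀ c : Fin 4 × Fin n → K, (∀ p, p ∉ D → c p = 0) → ∀ i j, j ∉ V → c (i, j) = 0 :=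
    fun c hc i j hi => hc _ (fun h => hi (mem_product.1 (hD h)).2)
  by_cases hcase : ∃ i₀ ∈ U, Hc 0 i₀ ≠ 0
  · obtain ⟨i₀, hi₀, hne⟩ := hcase
    obtain ⟨c, hc0, hcD, hcl⟩ := exists_supported D
      (κ := V ⊕ (↥(U.erase i₀) × Fin 2))
      (Sum.elim (fun j => colF j) (fun p => rowF p.1 p.2)) (by
        simp only [Fintype.card_sum, Fintype.card_prod, Fintype.card_coe, Fintype.card_fin,
          card_erase_of_mem hi₀]
        omega)
    have hC : ∀ j, ∑ i, Hc 0 i * c (i, j) = 0 := by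
      intro j
      by_cases hj : j ∈ V
      · rw [← hcol]; exact hcl (Sum.inl ⟨j, hj⟩)
      · exact sum_eq_zero (fun i _ => by rw [hoffV c hcD i j hj, mul_zero])
    have hR : ∀ i, i ≠ i₀ → ∀ t, ∑ j, Hr t j * c (i, j) = 0 := by
      intro i hi t
      by_cases hiU : i ∈ U
      · rw [← hrow]; exact hcl (Sum.inr (⟨i, mem_erase.2 ⟨hi, hiU⟩⟩, t))
      · exact sum_eq_zero (fun j _ => by rw [hoffU c hcD i j hiU, mul_zero])
    refine ⟨c, hc0, hcD, hC, ?_⟩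
    intro i t
    by_cases hi : i = i₀
    · subst hi
      have h1 : ∑ i', Hc 0 i' * ∑ j, Hr t j * c (i', j) = 0 := by
        simp_rw [mul_sum]
        rw [sum_comm]
        apply sum_eq_zero
        intro j _
        have := hC j
        calc ∑ i', Hc 0 i' * (Hr t j * c (i', j)) = Hr t j * ∑ i', Hc 0 i' * c (i', j) := by
              rw [mul_sum]; exact sum_congr rfl (fun _ _ => by ring)
          _ = 0 := by rw [this, mul_zero]
      rw [sum_eq_single i (fun b _ hb => by rw [hR b hb t, mul_zero])
        (fun h => absurd (mem_univ _) h)] at h1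
      exact (mul_eq_zero.1 h1).resolve_left hne
    · exact hR i hi t
  · push Not at hcase
    obtain ⟨c, hc0, hcD, hcl⟩ := exists_supported D
      (κ := U × Fin 2) (fun p => rowF p.1 p.2) (by
        simp only [Fintype.card_prod, Fintype.card_coe, Fintype.card_fin]
        omega)
    refine ⟨c, hc0, hcD, ?_, ?_⟩
    · intro j
      apply sum_eq_zero
      intro i _
      by_cases hiU : i ∈ U
      · rw [hcase i hiU, zero_mul]
      · rw [hoffU c hcD i j hiU, mul_zero]
    · intro i t
      by_cases hiU : i ∈ U
      · rw [← hrow]; exact hcl (⟨i, hiU⟩, t)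
      · exact sum_eq_zero (fun j _ => by rw [hoffU c hcD i j hiU, mul_zero])

end Dim

section Core

variable {F : Type} [Field F] [DecidableEq F] {n : ℕ}

theorem two_zero {α : Fin n → F} (hα : Function.Injective α) (w : Fin n → F)
    (h1 : ∑ j, w j = 0) (h2 : ∑ j, w j * α j = 0) (s : Finset (Fin n)) (hs : s.card ≤ 2)
    (hw : ∀ j, j ∉ s → w j = 0) : ∀ j, w j = 0 := by
  rw [← sum_subset (subset_univ s) (fun j _ hj => hw j hj)] at h1
  rw [← sum_subset (subset_univ s) (fun j _ hj => by rw [hw j hj, zero_mul])] at h2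
  have : ∀ j ∈ s, w j = 0 := by
    have : s.card = 0 ∨ s.card = 1 ∨ s.card = 2 := by omega
    rcases this with h | h | h
    · rw [card_eq_zero.1 h]; simp
    · obtain ⟨a, rfl⟩ := card_eq_one.1 h
      intro j hj
      rw [mem_singleton.1 hj]
      simpa using h1
    · obtain ⟨a, b, hab, rfl⟩ := card_eq_two.1 h
      rw [sum_pair hab] at h1 h2
      have ha : w a = 0 := by
        have : w a * (α a - α b) = 0 := by linear_combination h2 - α b * h1
        exact (mul_eq_zero.1 this).resolve_right (sub_ne_zero.2 (hα.ne hab))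
      have hb : w b = 0 := by rw [ha, zero_add] at h1; exact h1
      intro j hj
      rcases mem_insert.1 hj with rfl | hj
      · exact ha
      · rw [mem_singleton.1 hj]; exact hb
  intro j
  by_cases hj : j ∈ s
  · exact this j hj
  · exact hw j hj

/-- The regular-graph structure. -/
theorem regular {E : Finset (Fin 4 × Fin n)} (hE : CorrectableForTopology 4 n 1 2 E)
    {α : Fin n → F} (hα : Function.Injective α) (c : Fin 4 → Fin n → F)
    (hcE : ∀ p : Fin 4 × Fin n, p ∉ E → c p.1 p.2 = 0)
    (hcol : ∀ j, ∑ i, c i j = 0) (hr1 : ∀ i, ∑ j, c i j = 0) (hr2 : ∀ i, ∑ j, c i j * α j = 0)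
    (hne : ∃ i j, c i j ≠ 0) :
    (∀ i, (univ.filter (fun j => c i j ≠ 0)).card = 3) ∧
    (∀ j, (univ.filter (fun i => c i j ≠ 0)).card ≤ 2) := by
  set R : Fin 4 → Finset (Fin n) := fun i => univ.filter (fun j => c i j ≠ 0) with hR
  set K : Fin n → Finset (Fin 4) := fun j => univ.filter (fun i => c i j ≠ 0) with hK
  have mR : ∀ i j, j ∈ R i ↔ c i j ≠ 0 := fun i j => by simp [hR]
  have mK : ∀ i j, i ∈ K j ↔ c i j ≠ 0 := fun i j => by simp [hK]
  have hR3 : ∀ i, (R i).Nonempty → 3 ≤ (R i).card := by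
    rintro i ⟨j, hj⟩
    by_contra h
    exact (mR i j).1 hj (two_zero hα (c i) (hr1 i) (hr2 i) (R i) (by omega)
      (fun j hj => by by_contra h; exact hj ((mR i j).2 h)) j)
  have hK2 : ∀ j, (K j).Nonempty → 2 ≤ (K j).card := by
    rintro j ⟨i, hi⟩
    by_contra h
    have h1 : (K j).card = 1 := by
      have := card_pos.2 ⟨i, hi⟩
      omega
    obtain ⟨a, ha⟩ := card_eq_one.1 h1
    have hs := hcol j
    rw [sum_eq_single i (fun b _ hb => by
      by_contra h
      have h2 := (mK b j).2 h
      rw [ha, mem_singleton] at h2 hi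
      exact hb (h2.trans hi.symm)) (fun h => absurd (mem_univ _) h)] at hs
    exact (mK i j).1 hi hs
  set D : Finset (Fin 4 × Fin n) := univ.filter (fun p => c p.1 p.2 ≠ 0) with hD
  have hDR : D.card = ∑ i, (R i).card := by
    rw [hD, card_filter, ← univ_product_univ, sum_product]
    exact sum_congr rfl (fun i _ => by rw [hR, card_filter])
  have hDK : D.card = ∑ j, (K j).card := by
    rw [hD, card_filter, ← univ_product_univ, sum_product_right]
    exact sum_congr rfl (fun i _ => by rw [hK, card_filter])
  set U := univ.filter (fun i => (R i).Nonempty) with hU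
  set V := univ.filter (fun j => (K j).Nonempty) with hV
  have hDR' : D.card = ∑ i ∈ U, (R i).card := by
    rw [hDR]; symm
    apply sum_subset (subset_univ _)
    intro i _ hi
    rw [card_eq_zero, ← not_nonempty_iff_eq_empty]
    exact fun h => hi (mem_filter.2 ⟨mem_univ _, h⟩)
  have hDK' : D.card = ∑ j ∈ V, (K j).card := by
    rw [hDK]; symm
    apply sum_subset (subset_univ _)
    intro i _ hi
    rw [card_eq_zero, ← not_nonempty_iff_eq_empty]
    exact fun h => hi (mem_filter.2 ⟨mem_univ _, h⟩)
  obtain ⟨i, j, hij⟩ := hne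
  have hRV : R i ⊆ V := fun j hj => mem_filter.2 ⟨mem_univ _, ⟨i, (mK i j).2 ((mR i j).1 hj)⟩⟩
  have hV3 : 3 ≤ V.card := (hR3 i ⟨j, (mR i j).2 hij⟩).trans (card_le_card hRV)
  have hUn : U.Nonempty := ⟨i, mem_filter.2 ⟨mem_univ _, ⟨j, (mR i j).2 hij⟩⟩⟩
  have hdim := dim_lemma hE U V hUn (by omega) D
    (fun p hp => by by_contra h; exact (mem_filter.1 hp).2 (hcE p h))
    (fun p hp => by
      have := (mem_filter.1 hp).2
      exact mem_product.2 ⟨mem_filter.2 ⟨mem_univ _, ⟨p.2, (mR _ _).2 this⟩⟩,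
        mem_filter.2 ⟨mem_univ _, ⟨p.1, (mK _ _).2 this⟩⟩⟩)
  have hU4 : U.card ≤ 4 := (card_le_univ U).trans (by simp)
  have hD3 : U.card * 3 ≤ D.card := by
    rw [hDR']; exact card_nsmul_le_sum _ _ _ (fun i hi => hR3 i (mem_filter.1 hi).2)
  have hD2 : V.card * 2 ≤ D.card := by
    rw [hDK']; exact card_nsmul_le_sum _ _ _ (fun i hi => hK2 i (mem_filter.1 hi).2)
  have hUc : U.card = 4 := by omega
  have hDc : D.card = 12 := by omega
  have hVc : V.card = 6 := by omega
  have hUu : U = univ := by rw [← card_eq_iff_eq_univ, hUc]; simp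
  constructor
  · intro i
    have hle : ∀ i ∈ U, 3 ≤ (R i).card := fun i hi => hR3 i (mem_filter.1 hi).2
    have hs : ∑ i ∈ U, 3 = ∑ i ∈ U, (R i).card := by
      rw [← hDR', sum_const, hUc, hDc]; rfl
    exact ((sum_eq_sum_iff_of_le hle).1 hs i (by rw [hUu]; exact mem_univ _)).symm
  · intro j
    by_cases hj : (K j).Nonempty
    · have hle : ∀ i ∈ V, 2 ≤ (K i).card := fun i hi => hK2 i (mem_filter.1 hi).2
      have hs : ∑ i ∈ V, 2 = ∑ i ∈ V, (K i).card := by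
        rw [← hDK', sum_const, hVc, hDc]; rfl
      exact ((sum_eq_sum_iff_of_le hle).1 hs j (mem_filter.2 ⟨mem_univ _, hj⟩)).symm.le
    · change (K j).card ≤ 2
      rw [not_nonempty_iff_eq_empty.1 hj]; simp

/-- A nonzero codeword supported in a correctable pattern gives a bad 6-set. -/
theorem exists_bad {E : Finset (Fin 4 × Fin n)} (hE : CorrectableForTopology 4 n 1 2 E)
    {α : Fin n → F} (hα : Function.Injective α) (c : Fin 4 → Fin n → F)
    (hcE : ∀ p : Fin 4 × Fin n, p ∉ E → c p.1 p.2 = 0)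
    (hcol : ∀ j, ∑ i, c i j = 0) (hr1 : ∀ i, ∑ j, c i j = 0) (hr2 : ∀ i, ∑ j, c i j * α j = 0)
    (hne : ∃ i j, c i j ≠ 0) :
    ∃ y : Fin 6 → Fin n, Function.Injective y ∧ hexP (fun i => α (y i)) = 0 := by
  obtain ⟨hR3, hK2⟩ := regular hE hα c hcE hcol hr1 hr2 hne
  set R : Fin 4 → Finset (Fin n) := fun i => univ.filter (fun j => c i j ≠ 0) with hR
  have mR : ∀ i j, j ∈ R i ↔ c i j ≠ 0 := fun i j => by simp [hR]
  have hR3 : ∀ i, (R i).card = 3 := hR3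
  have hK3 : ∀ j u v w, u ≠ v → u ≠ w → v ≠ w → c u j ≠ 0 → c v j ≠ 0 → c w j = 0 := by
    intro j u v w huv huw hvw hu hv
    by_contra hw
    have h1 : ({u, v, w} : Finset (Fin 4)) ⊆ univ.filter (fun i => c i j ≠ 0) := by
      intro i hi
      simp only [mem_insert, mem_singleton] at hi
      rcases hi with rfl | rfl | rfl <;> simpa
    have h2 := (card_le_card h1).trans (hK2 j)
    rw [card_eq_three.2 ⟨u, v, w, huv, huw, hvw, rfl⟩] at h2
    omega
  -- column equations
  have hce : ∀ j u v, u ≠ v → c u j ≠ 0 → c v j ≠ 0 → c u j + c v j = 0 := by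
    intro j u v huv hu hv
    have := hcol j
    rw [← sum_subset (subset_univ {u, v}) ?_, sum_pair huv] at this
    · exact this
    · intro w _ hw
      simp only [mem_insert, mem_singleton, not_or] at hw
      exact hK3 j u v w huv (Ne.symm hw.1) (Ne.symm hw.2) hu hv
  -- no double edges
  have hinter : ∀ u v, u ≠ v → (R u ∩ R v).card ≤ 1 := by
    intro u v huv
    by_contra hlt
    push Not at hlt
    have hcu := card_union_add_card_inter (R u) (R v)
    have hsd := card_sdiff_add_card_eq_card
      (inter_subset_left.trans subset_union_left : R u ∩ R v ⊆ R u ∪ R v)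
    rw [hR3, hR3] at hcu
    have hw := two_zero hα (fun j => c u j + c v j)
      (by rw [sum_add_distrib, hr1, hr1, add_zero])
      (by simp_rw [add_mul]; rw [sum_add_distrib, hr2, hr2, add_zero])
      ((R u ∪ R v) \ (R u ∩ R v)) (by omega) (by
        intro j hj
        simp only [mem_sdiff, mem_union, mem_inter, mR, not_and_or, not_not] at hj
        by_cases hu : c u j = 0
        · by_cases hv : c v j = 0
          · rw [hu, hv, add_zero]
          · tauto
        · by_cases hv : c v j = 0
          · tauto
          · exact hce j u v huv hu hv)
    have hRe : ∀ j, c u j ≠ 0 ↔ c v j ≠ 0 := by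
      intro j
      have := hw j
      rw [add_eq_zero_iff_eq_neg.1 this, neg_ne_zero]
    have hsub : ({u, v} : Finset (Fin 4)) ×ˢ R u ⊆ E := by
      intro p hp
      obtain ⟨h1, h2⟩ := mem_product.1 hp
      by_contra hpE
      have h0 := hcE p hpE
      have h3 := (mR _ _).1 h2
      simp only [mem_insert, mem_singleton] at h1
      rcases h1 with h1 | h1
      · rw [h1] at h0; exact h3 h0
      · rw [h1] at h0; exact (hRe _).1 h3 h0
    have := dim_lemma hE {u, v} (R u) ⟨u, by simp⟩ (by rw [hR3]; omega) _ hsub (Subset.refl _)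
    rw [card_product, card_pair huv, hR3] at this
    omega
  -- every pair of rows shares a column
  have hpair : ∀ u v, u ≠ v → ∃ j, c u j ≠ 0 ∧ c v j ≠ 0 := by
    intro u v huv
    have hsub : R u ⊆ (univ.erase u).biUnion (fun w => R u ∩ R w) := by
      intro j hj
      by_contra hno
      have hz : ∀ w, w ≠ u → c w j = 0 := by
        intro w hw
        by_contra h
        exact hno (mem_biUnion.2 ⟨w, mem_erase.2 ⟨hw, mem_univ _⟩,
          mem_inter.2 ⟨hj, (mR _ _).2 h⟩⟩)
      have := hcol j
      rw [sum_eq_single u (fun w _ hw => hz w hw) (fun h => absurd (mem_univ _) h)] at this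
      exact (mR _ _).1 hj this
    by_contra hno
    push Not at hno
    have he : R u ∩ R v = ∅ := by
      rw [← not_nonempty_iff_eq_empty]
      rintro ⟨j, hj⟩
      obtain ⟨h1, h2⟩ := mem_inter.1 hj
      exact (mR _ _).1 h2 (hno j ((mR _ _).1 h1))
    have h1 := (card_le_card hsub).trans card_biUnion_le
    have hv : v ∈ univ.erase u := mem_erase.2 ⟨huv.symm, mem_univ _⟩
    rw [← add_sum_erase _ _ hv, he, card_empty, zero_add, hR3] at h1
    have h2 : ∑ w ∈ (univ.erase u).erase v, (R u ∩ R w).card ≤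
        ((univ.erase u).erase v).card • 1 :=
      sum_le_card_nsmul _ _ _ (fun w hw =>
        hinter u w (Ne.symm (mem_erase.1 (mem_erase.1 hw).2).1))
    rw [card_erase_of_mem hv, card_erase_of_mem (mem_univ _)] at h2
    simp at h2
    omega
  -- row equations
  have hrow : ∀ (u : Fin 4) (a b d : Fin n) (g : Fin n → F), a ≠ b → a ≠ d → b ≠ d →
      c u a ≠ 0 → c u b ≠ 0 → c u d ≠ 0 → ∑ j, c u j * g j = 0 →
      c u a * g a + c u b * g b + c u d * g d = 0 := by
    intro u a b d g hab had hbd ha hb hd hs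
    have h1 : ({a, b, d} : Finset (Fin n)) ⊆ R u := by
      intro i hi
      simp only [mem_insert, mem_singleton] at hi
      rcases hi with rfl | rfl | rfl <;> exact (mR _ _).2 (by assumption)
    have h2 : ({a, b, d} : Finset (Fin n)) = R u := by
      apply eq_of_subset_of_card_le h1
      rw [card_eq_three.2 ⟨a, b, d, hab, had, hbd, rfl⟩, hR3]
    rw [← sum_subset (subset_univ (R u)) (fun j _ hj => by
      rw [mR, not_not] at hj; rw [hj, zero_mul]), ← h2] at hs
    rw [sum_insert (by simp [hab, had]), sum_pair hbd] at hs
    rw [← hs]; ring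
  obtain ⟨j01, p01, q01⟩ := hpair 0 1 (by decide)
  obtain ⟨j02, p02, q02⟩ := hpair 0 2 (by decide)
  obtain ⟨j03, p03, q03⟩ := hpair 0 3 (by decide)
  obtain ⟨j12, p12, q12⟩ := hpair 1 2 (by decide)
  obtain ⟨j13, p13, q13⟩ := hpair 1 3 (by decide)
  obtain ⟨j23, p23, q23⟩ := hpair 2 3 (by decide)
  have hdis : ∀ j j' u v w, u ≠ v → u ≠ w → v ≠ w → c u j ≠ 0 → c v j ≠ 0 → c w j' ≠ 0 →
      j ≠ j' := by
    intro j j' u v w h1 h2 h3 hu hv hw he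
    exact hw (he ▸ hK3 j u v w h1 h2 h3 hu hv)
  have n1 : j01 ≠ j02 := hdis _ _ 0 1 2 (by decide) (by decide) (by decide) p01 q01 q02
  have n2 : j01 ≠ j03 := hdis _ _ 0 1 3 (by decide) (by decide) (by decide) p01 q01 q03
  have n3 : j01 ≠ j12 := hdis _ _ 0 1 2 (by decide) (by decide) (by decide) p01 q01 q12
  have n4 : j01 ≠ j13 := hdis _ _ 0 1 3 (by decide) (by decide) (by decide) p01 q01 q13
  have n5 : j01 ≠ j23 := hdis _ _ 0 1 2 (by decide) (by decide) (by decide) p01 q01 p23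
  have n6 : j02 ≠ j03 := hdis _ _ 0 2 3 (by decide) (by decide) (by decide) p02 q02 q03
  have n7 : j02 ≠ j12 := hdis _ _ 0 2 1 (by decide) (by decide) (by decide) p02 q02 p12
  have n8 : j02 ≠ j13 := hdis _ _ 0 2 1 (by decide) (by decide) (by decide) p02 q02 p13
  have n9 : j02 ≠ j23 := hdis _ _ 0 2 3 (by decide) (by decide) (by decide) p02 q02 q23
  have n10 : j03 ≠ j12 := hdis _ _ 0 3 1 (by decide) (by decide) (by decide) p03 q03 p12
  have n11 : j03 ≠ j13 := hdis _ _ 0 3 1 (by decide) (by decide) (by decide) p03 q03 p13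
  have n12 : j03 ≠ j23 := hdis _ _ 0 3 2 (by decide) (by decide) (by decide) p03 q03 p23
  have n13 : j12 ≠ j13 := hdis _ _ 1 2 3 (by decide) (by decide) (by decide) p12 q12 q13
  have n14 : j12 ≠ j23 := hdis _ _ 1 2 3 (by decide) (by decide) (by decide) p12 q12 q23
  have n15 : j13 ≠ j23 := hdis _ _ 1 3 2 (by decide) (by decide) (by decide) p13 q13 p23
  refine ⟨![j02, j03, j01, j13, j12, j23], ?_, ?_⟩
  · rw [← List.nodup_ofFn]
    simp [n1, n2, n3, n4, n5, n6, n7, n8, n9, n10, n11, n12, n13, n14, n15, n1.symm, n2.symm,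
      n4.symm, n3.symm, n13.symm]
  · have hr1' : ∀ i, ∑ j, c i j * (fun _ => (1 : F)) j = 0 := by simpa using hr1
    have e01 := hce j01 0 1 (by decide) p01 q01
    have e02 := hce j02 0 2 (by decide) p02 q02
    have e12 := hce j12 1 2 (by decide) p12 q12
    have r0 := hrow 0 j01 j02 j03 _ n1 n2 n6 p01 p02 p03 (hr1' 0)
    have s0 := hrow 0 j01 j02 j03 α n1 n2 n6 p01 p02 p03 (hr2 0)
    have r1 := hrow 1 j01 j12 j13 _ n3 n4 n13 q01 p12 p13 (hr1' 1)
    have s1 := hrow 1 j01 j12 j13 α n3 n4 n13 q01 p12 p13 (hr2 1)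
    have r2 := hrow 2 j02 j12 j23 _ n7 n9 n14 q02 q12 p23 (hr1' 2)
    have s2 := hrow 2 j02 j12 j23 α n7 n9 n14 q02 q12 p23 (hr2 2)
    have f0 : c 0 j02 * (α j02 - α j03) = - (c 0 j01 * (α j01 - α j03)) := by
      linear_combination s0 - α j03 * r0
    have f1 : c 1 j12 * (α j12 - α j13) = c 0 j01 * (α j01 - α j13) := by
      linear_combination s1 - α j13 * r1 - (α j01 - α j13) * e01
    have f2 : c 0 j02 * (α j02 - α j23) = - (c 1 j12 * (α j12 - α j23)) := by
      linear_combination - (s2 - α j23 * r2) + (α j02 - α j23) * e02 + (α j12 - α j23) * e12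
    have key : (c 0 j01 * c 0 j02 * c 1 j12) * ((α j02 - α j03) * (α j01 - α j13) * (α j12 - α j23)
        + (α j03 - α j01) * (α j13 - α j12) * (α j23 - α j02)) = 0 := by
      have : (c 0 j02 * (α j02 - α j03)) * (c 0 j01 * (α j01 - α j13)) *
          (c 1 j12 * (α j12 - α j23)) = (c 0 j01 * (α j01 - α j03)) * (c 1 j12 * (α j12 - α j13)) *
          (c 0 j02 * (α j02 - α j23)) := by
        rw [f0, f1, f2]; ring
      linear_combination this
    have := (mul_eq_zero.1 key).resolve_left (mul_ne_zero (mul_ne_zero p01 p02) p12)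
    simpa [hexP] using this

end Core
end MRProof

/-- there is an absolute constant `C₁ > 0` such that for all
sufficiently large `n` and every prime power `q > C₁ · n^5 / log n`, there exists a
maximally recoverable code instantiating `T_{4×n}(1,2,0)` over the field with `q`
elements. -/
theorem exists_MR_code_T_4_n_1_2_0 :
    ∃ C₁ : ℝ, 0 < C₁ ∧ ∃ N : ℕ, ∀ n : ℕ, N ≤ n → ∀ q : ℕ, IsPrimePow q →
      C₁ * (n : ℝ) ^ 5 / Real.log n < (q : ℝ) →
      ∀ (F : Type) [Field F] [Fintype F], Fintype.card F = q →
        ∃ C : Set (Matrix (Fin 4) (Fin n) F), IsMaximallyRecoverable F 4 n 1 2 C := by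
  obtain ⟨C₁, hC₁, N, h⟩ := MRProof.exists_indep (5 ^ 6)
  refine ⟨C₁, hC₁, N, ?_⟩
  intro n hn q _ hq F _ _ hF
  classical
  rw [← hF] at hq
  obtain ⟨S, hSn, hS⟩ := h n hn F hq (MRProof.badE F) MRProof.badE_card MRProof.badE_codeg
  let eqv := S.equivFinOfCardEq hSn
  let α : Fin n → F := fun j => (eqv.symm j : F)
  have hα : Function.Injective α := fun a b hab => eqv.symm.injective (Subtype.ext hab)
  have hαS : ∀ j, α j ∈ S := fun j => (eqv.symm j).2
  let Hc : Matrix (Fin 1) (Fin 4) F := fun _ _ => 1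
  let Hr : Matrix (Fin 2) (Fin n) F := fun t j => if t = 0 then 1 else α j
  refine ⟨{c | (∀ j, Hc.mulVec (fun i => c i j) = 0) ∧ ∀ i, Hr.mulVec (c i) = 0},
    ⟨Hc, Hr, rfl⟩, ?_⟩
  intro E hE c₁ hc₁ c₂ hc₂ hagree
  have hcol : ∀ c : Matrix (Fin 4) (Fin n) F, (∀ j, Hc.mulVec (fun i => c i j) = 0) →
      ∀ j, ∑ i, c i j = 0 := by
    intro c hc j
    have := congrFun (hc j) 0
    simpa [Matrix.mulVec, dotProduct, Hc] using this
  have hrow1 : ∀ c : Matrix (Fin 4) (Fin n) F, (∀ i, Hr.mulVec (c i) = 0) →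
      ∀ i, ∑ j, c i j = 0 := by
    intro c hc i
    have := congrFun (hc i) 0
    simpa [Matrix.mulVec, dotProduct, Hr] using this
  have hrow2 : ∀ c : Matrix (Fin 4) (Fin n) F, (∀ i, Hr.mulVec (c i) = 0) →
      ∀ i, ∑ j, c i j * α j = 0 := by
    intro c hc i
    have := congrFun (hc i) 1
    simpa [Matrix.mulVec, dotProduct, Hr, mul_comm] using this
  by_contra hne
  have hne' : ∃ i j, c₁ i j - c₂ i j ≠ 0 := by
    by_contra hno
    push Not at hno
    exact hne (by ext i j; exact sub_eq_zero.1 (hno i j))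
  obtain ⟨y, hy, hP⟩ := MRProof.exists_bad hE hα (fun i j => c₁ i j - c₂ i j)
    (fun p hp => sub_eq_zero.2 (hagree p hp))
    (fun j => by rw [Finset.sum_sub_distrib, hcol c₁ hc₁.1, hcol c₂ hc₂.1, sub_zero])
    (fun i => by rw [Finset.sum_sub_distrib, hrow1 c₁ hc₁.2, hrow1 c₂ hc₂.2, sub_zero])
    (fun i => by
      simp_rw [sub_mul]
      rw [Finset.sum_sub_distrib, hrow2 c₁ hc₁.2, hrow2 c₂ hc₂.2, sub_zero]) hne'
  refine hS (Finset.univ.image (fun i => α (y i)))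
    (MRProof.mem_badE.2 ⟨_, fun a b hab => hy (hα hab), hP, rfl⟩) ?_
  intro v hv
  obtain ⟨i, -, rfl⟩ := Finset.mem_image.1 hv
  exact hαS _
end

section
/- Let n ≥ 8 and let q be a prime power with q < (n-3)^2/4 + 2. Then for every tensor product code C = C_col ⊗ C_row over F_q in which C_col is a [4,3,2] MDS code and C_row is an [n,n-2,3] MDS code, C is not a maximally recoverable code for the grid-like topology T_{4×n}(1,2,0); that is, there exists an erasure pattern that is correctable for the topology but not correctable by C. -/
open scoped Classical in
/-- `C` is an `[N, K, N-K+1]` MDS linear code over `F`: it has dimension `K` and every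
nonzero codeword has Hamming weight at least `N - K + 1`. -/
def IsMDSCode (F : Type) [Field F] (N K : ℕ) (C : Submodule F (Fin N → F)) : Prop :=
  Module.finrank F C = K ∧
    ∀ v ∈ C, v ≠ 0 → N - K + 1 ≤ (Finset.univ.filter fun i => v i ≠ 0).card

/-- The tensor product code `C_col ⊗ C_row`: all `m × n` matrices whose columns lie in
`C_col` and whose rows lie in `C_row`. -/
def tensorCode {F : Type} [Field F] {m n : ℕ} (Ccol : Submodule F (Fin m → F))
    (Crow : Submodule F (Fin n → F)) : Set (Matrix (Fin m) (Fin n) F) :=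
  {c | (∀ j, (fun i => c i j) ∈ Ccol) ∧ ∀ i, c i ∈ Crow}

/-- Parity-check map of a code. -/
theorem exists_parity {F : Type} [Field F] {N K d : ℕ} (C : Submodule F (Fin N → F))
    (hK : Module.finrank F C = K) (hd : K + d = N) :
    ∃ h : Fin N → Fin d → F, ∀ v : Fin N → F, v ∈ C ↔ ∀ k, ∑ j, v j * h j k = 0 := by
  have h1 := Submodule.finrank_quotient_add_finrank C
  rw [Module.finrank_fin_fun] at h1
  have h2 : Module.finrank F ((Fin N → F) ⧸ C) = d := by omega
  let e := LinearEquiv.ofFinrankEq ((Fin N → F) ⧸ C) (Fin d → F)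
    (by rw [h2, Module.finrank_fin_fun])
  refine ⟨fun j => e (C.mkQ (Pi.single j 1)), fun v => ?_⟩
  have hv : e (C.mkQ v) = ∑ j, v j • e (C.mkQ (Pi.single j 1)) := by
    conv_lhs => rw [pi_eq_sum_univ' v]
    simp [map_sum, map_smul]
  have : v ∈ C ↔ e (C.mkQ v) = 0 := by simp
  rw [this, hv, funext_iff]
  simp [Finset.sum_apply]

theorem sum_three {F : Type} [Field F] {n : ℕ} (f : Fin n → F) (a b c : Fin n)
    (hab : a ≠ b) (hac : a ≠ c) (hbc : b ≠ c)
    (hf : ∀ j, j ≠ a → j ≠ b → j ≠ c → f j = 0) : ∑ j, f j = f a + f b + f c := by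
  classical
  rw [← Finset.sum_subset (Finset.subset_univ ({a, b, c} : Finset (Fin n)))]
  · rw [Finset.sum_insert (by simp [hab, hac]), Finset.sum_insert (by simp [hbc]),
      Finset.sum_singleton]
    ring
  · intro x _ hx
    simp only [Finset.mem_insert, Finset.mem_singleton, not_or] at hx
    exact hf x hx.1 hx.2.1 hx.2.2

/-- The erasure pattern: edges of `K₄` as columns, vertices as rows. -/
def patE {n : ℕ} (P C a a' b b' : Fin n) : Finset (Fin 4 × Fin n) :=
  {(0, P), (1, P), (2, C), (3, C), (0, a), (2, a), (1, a'), (3, a'), (0, b), (3, b),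
    (1, b'), (2, b')}

theorem lin_solve {K : Type} [Field K] (h2 : (2 : K) ≠ 0)
    (p0 a0 b0 p1 a1 b1 c2 a2 b2 c3 a3 b3 : K)
    (X0 : 1 * p0 + 1 * a0 + 1 * b0 = 0) (Y0 : 0 * p0 + 1 * a0 + 2 * b0 = 0)
    (Y1 : 0 * p1 + 4 * a1 + 3 * b1 = 0)
    (X2 : 0 * c2 + 1 * a2 + 1 * b2 = 0) (Y2 : 1 * c2 + 1 * a2 + 3 * b2 = 0)
    (X3 : 0 * c3 + 1 * a3 + 1 * b3 = 0)
    (cP : p0 + p1 + 0 + 0 = 0) (cC : 0 + 0 + c2 + c3 = 0) (ca : a0 + 0 + a2 + 0 = 0)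
    (ca' : 0 + a1 + 0 + a3 = 0) (cb : b0 + 0 + 0 + b3 = 0) (cb' : 0 + b1 + b2 + 0 = 0) :
    (p0 = 0 ∧ a0 = 0 ∧ b0 = 0) ∧ (p1 = 0 ∧ a1 = 0 ∧ b1 = 0) ∧ (c2 = 0 ∧ a2 = 0 ∧ b2 = 0) ∧
      (c3 = 0 ∧ a3 = 0 ∧ b3 = 0) := by
  have e : 2 * b0 = 0 := by
    linear_combination Y1 - 4 * ca' + 4 * X3 - 4 * cb - 3 * cb' + 3 * X2 - 3 * ca + 3 * Y0
  have hb0 : b0 = 0 := (mul_eq_zero.1 e).resolve_left h2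
  subst hb0
  have ha0 : a0 = 0 := by linear_combination Y0
  subst ha0
  have hp0 : p0 = 0 := by linear_combination X0
  have hb3 : b3 = 0 := by linear_combination cb
  have ha2 : a2 = 0 := by linear_combination ca
  subst hp0 hb3 ha2
  have hp1 : p1 = 0 := by linear_combination cP
  have ha3 : a3 = 0 := by linear_combination X3
  have hb2 : b2 = 0 := by linear_combination X2
  subst hp1 ha3 hb2
  have ha1 : a1 = 0 := by linear_combination ca'
  have hb1 : b1 = 0 := by linear_combination cb'
  have hc2 : c2 = 0 := by linear_combination Y2
  subst hc2
  have hc3 : c3 = 0 := by linear_combination cC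
  simp [ha1, hb1, hc3]

theorem patE_correctable {n : ℕ} (P C a a' b b' : Fin n)
    (hnd : [P, C, a, a', b, b'].Nodup) :
    CorrectableForTopology 4 n 1 2 (patE P C a a' b b') := by
  have : Fact (Nat.Prime 5) := ⟨by norm_num⟩
  simp only [List.nodup_cons, List.mem_cons, List.not_mem_nil, or_false, not_or,
    not_false_eq_true, List.nodup_nil, and_true] at hnd
  obtain ⟨⟨hPC, hPa, hPa', hPb, hPb'⟩, ⟨hCa, hCa', hCb, hCb'⟩, ⟨haa', hab, hab'⟩,
    ⟨ha'b, ha'b'⟩, hbb'⟩ := hnd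
  let x : Fin n → ZMod 5 := fun j => if j = C then 0 else 1
  let y : Fin n → ZMod 5 := fun j => if j = P then 0 else if j = a then 1 else
    if j = a' then 4 else if j = b then 2 else if j = b' then 3 else 1
  refine ⟨ZMod 5, inferInstance, inferInstance, _, ⟨fun _ _ => 1, ![x, y], rfl⟩, ?_⟩
  rintro c₁ ⟨h1c, h1r⟩ c₂ ⟨h2c, h2r⟩ hE
  let d : Fin 4 → Fin n → ZMod 5 := fun i j => c₁ i j - c₂ i j
  have hd0 : ∀ i j, (i, j) ∉ patE P C a a' b b' → d i j = 0 := fun i j h =>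
    sub_eq_zero.2 (hE (i, j) h)
  have hcol : ∀ j, d 0 j + d 1 j + d 2 j + d 3 j = 0 := by
    intro j
    have e1 := congrFun (h1c j) 0
    have e2 := congrFun (h2c j) 0
    simp [Matrix.mulVec, dotProduct, Fin.sum_univ_four] at e1 e2
    simp only [d]
    linear_combination e1 - e2
  have hx : ∀ i, ∑ j, x j * d i j = 0 := by
    intro i
    have e1 := congrFun (h1r i) 0
    have e2 := congrFun (h2r i) 0
    simp [Matrix.mulVec, dotProduct] at e1 e2
    simp only [d, mul_sub, Finset.sum_sub_distrib, e1, e2, sub_zero]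
  have hy : ∀ i, ∑ j, y j * d i j = 0 := by
    intro i
    have e1 := congrFun (h1r i) 1
    have e2 := congrFun (h2r i) 1
    simp [Matrix.mulVec, dotProduct] at e1 e2
    simp only [d, mul_sub, Finset.sum_sub_distrib, e1, e2, sub_zero]
  have z0 : ∀ j, j ≠ P → j ≠ a → j ≠ b → d 0 j = 0 := fun j h1 h2 h3 =>
    hd0 0 j (by simp [patE, h1, h2, h3])
  have z1 : ∀ j, j ≠ P → j ≠ a' → j ≠ b' → d 1 j = 0 := fun j h1 h2 h3 =>
    hd0 1 j (by simp [patE, h1, h2, h3])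
  have z2 : ∀ j, j ≠ C → j ≠ a → j ≠ b' → d 2 j = 0 := fun j h1 h2 h3 =>
    hd0 2 j (by simp [patE, h1, h2, h3])
  have z3 : ∀ j, j ≠ C → j ≠ a' → j ≠ b → d 3 j = 0 := fun j h1 h2 h3 =>
    hd0 3 j (by simp [patE, h1, h2, h3])
  have X0 := hx 0
  have X1 := hx 1
  have X2 := hx 2
  have X3 := hx 3
  have Y0 := hy 0
  have Y1 := hy 1
  have Y2 := hy 2
  have Y3 := hy 3
  rw [sum_three _ P a b hPa hPb hab (fun j h1 h2 h3 => by rw [z0 j h1 h2 h3, mul_zero])] at X0 Y0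
  rw [sum_three _ P a' b' hPa' hPb' ha'b'
    (fun j h1 h2 h3 => by rw [z1 j h1 h2 h3, mul_zero])] at X1 Y1
  rw [sum_three _ C a b' hCa hCb' hab'
    (fun j h1 h2 h3 => by rw [z2 j h1 h2 h3, mul_zero])] at X2 Y2
  rw [sum_three _ C a' b hCa' hCb ha'b
    (fun j h1 h2 h3 => by rw [z3 j h1 h2 h3, mul_zero])] at X3 Y3
  have xC : x C = 0 := by simp [x]
  have xP : x P = 1 := by simp [x, hPC]
  have xa : x a = 1 := by simp [x, Ne.symm hCa]
  have xa' : x a' = 1 := by simp [x, Ne.symm hCa']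
  have xb : x b = 1 := by simp [x, Ne.symm hCb]
  have xb' : x b' = 1 := by simp [x, Ne.symm hCb']
  have yP : y P = 0 := by simp [y]
  have yC : y C = 1 := by simp [y, Ne.symm hPC, hCa, hCa', hCb, hCb']
  have ya : y a = 1 := by simp [y, Ne.symm hPa]
  have ya' : y a' = 4 := by simp [y, Ne.symm hPa', Ne.symm haa']
  have yb : y b = 2 := by simp [y, Ne.symm hPb, Ne.symm hab, Ne.symm ha'b]
  have yb' : y b' = 3 := by
    simp [y, Ne.symm hPb', Ne.symm hab', Ne.symm ha'b', Ne.symm hbb']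
  rw [xP, xa, xb] at X0
  rw [xP, xa', xb'] at X1
  rw [xC, xa, xb'] at X2
  rw [xC, xa', xb] at X3
  rw [yP, ya, yb] at Y0
  rw [yP, ya', yb'] at Y1
  rw [yC, ya, yb'] at Y2
  rw [yC, ya', yb] at Y3
  have cP := hcol P
  have cC := hcol C
  have ca := hcol a
  have ca' := hcol a'
  have cb := hcol b
  have cb' := hcol b'
  rw [z2 P hPC hPa hPb', z3 P hPC hPa' hPb] at cP
  rw [z0 C (Ne.symm hPC) hCa hCb, z1 C (Ne.symm hPC) hCa' hCb'] at cC
  rw [z1 a (Ne.symm hPa) haa' hab', z3 a (Ne.symm hCa) haa' hab] at ca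
  rw [z0 a' (Ne.symm hPa') (Ne.symm haa') ha'b,
    z2 a' (Ne.symm hCa') (Ne.symm haa') ha'b'] at ca'
  rw [z1 b (Ne.symm hPb) (Ne.symm ha'b) hbb', z2 b (Ne.symm hCb) (Ne.symm hab) hbb'] at cb
  rw [z0 b' (Ne.symm hPb') (Ne.symm hab') (Ne.symm hbb'),
    z3 b' (Ne.symm hCb') (Ne.symm ha'b') (Ne.symm hbb')] at cb'
  have h2 : (2 : ZMod 5) ≠ 0 := by
    intro h
    have h' : ((2 : ℕ) : ZMod 5) = 0 := by exact_mod_cast h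
    rw [ZMod.natCast_eq_zero_iff] at h'
    omega
  obtain ⟨⟨P0, a0, b0⟩, ⟨P1, a1, b1⟩, ⟨C2, a2, b2⟩, ⟨C3, a3, b3⟩⟩ :=
    lin_solve h2 _ _ _ _ _ _ _ _ _ _ _ _ X0 Y0 Y1 X2 Y2 X3 cP cC ca ca' cb cb'
  have key : ∀ i j, d i j = 0 := by
    intro i j
    by_cases h : (i, j) ∈ patE P C a a' b b'
    · simp only [patE, Finset.mem_insert, Finset.mem_singleton, Prod.mk.injEq] at h
      rcases h with h | h | h | h | h | h | h | h | h | h | h | h <;>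
        (obtain ⟨rfl, rfl⟩ := h; assumption)
    · exact hd0 i j h
  ext i j
  exact sub_eq_zero.1 (key i j)

/-- Weight three vector. -/
def vec3 {F : Type} [Field F] {n : ℕ} (i j k : Fin n) (r s t : F) : Fin n → F :=
  fun l => if l = i then r else if l = j then s else if l = k then t else 0

theorem vec3_sum {F : Type} [Field F] {n : ℕ} (i j k : Fin n) (r s t : F) (h : Fin n → F)
    (hij : i ≠ j) (hik : i ≠ k) (hjk : j ≠ k) :
    ∑ l, vec3 i j k r s t l * h l = r * h i + s * h j + t * h k := by
  rw [sum_three _ i j k hij hik hjk]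
  · simp [vec3, Ne.symm hij, Ne.symm hik, Ne.symm hjk]
  · intro l h1 h2 h3
    simp [vec3, h1, h2, h3]

theorem patE_not_corrected {F : Type} [Field F] {n : ℕ} (P C a a' b b' : Fin n)
    (hnd : [P, C, a, a', b, b'].Nodup) (Ccol : Submodule F (Fin 4 → F))
    (Crow : Submodule F (Fin n → F)) (g : Fin 4 → F) (x y : Fin n → F)
    (hg : ∀ i, g i ≠ 0)
    (hcol : ∀ v, v ∈ Ccol ↔ ∑ i, v i * g i = 0)
    (hrow : ∀ v, v ∈ Crow ↔ ∑ j, v j * x j = 0 ∧ ∑ j, v j * y j = 0)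
    (hD : ∀ i j, i ≠ j → x i * y j - x j * y i ≠ 0)
    (hinv : (x a * y C - x C * y a) * (x a' * y C - x C * y a') *
        ((x b * y P - x P * y b) * (x b' * y P - x P * y b')) =
      (x b * y C - x C * y b) * (x b' * y C - x C * y b') *
        ((x a * y P - x P * y a) * (x a' * y P - x P * y a'))) :
    ¬ CorrectsPattern (tensorCode Ccol Crow) (patE P C a a' b b') := by
  simp only [List.nodup_cons, List.mem_cons, List.not_mem_nil, or_false, not_or,
    not_false_eq_true, List.nodup_nil, and_true] at hnd
  obtain ⟨⟨hPC, hPa, hPa', hPb, hPb'⟩, ⟨hCa, hCa', hCb, hCb'⟩, ⟨haa', hab, hab'⟩,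
    ⟨ha'b, ha'b'⟩, hbb'⟩ := hnd
  obtain ⟨D, hDdef⟩ : ∃ D : Fin n → Fin n → F, ∀ i j, D i j = x i * y j - x j * y i :=
    ⟨_, fun _ _ => rfl⟩
  simp only [← hDdef] at hD hinv
  have hanti : ∀ i j, D j i = - D i j := fun i j => by rw [hDdef, hDdef]; ring
  have hpl : ∀ i j k l, D i j * D k l - D i k * D j l + D i l * D j k = 0 := fun i j k l => by
    simp only [hDdef]; ring
  let w : Fin n → Fin n → Fin n → F → Fin n → F := fun i j k r =>
    vec3 i j k (r * D j k) (r * D k i) (r * D i j)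
  have hw : ∀ i j k r, i ≠ j → i ≠ k → j ≠ k → w i j k r ∈ Crow := by
    intro i j k r h1 h2 h3
    rw [hrow, vec3_sum _ _ _ _ _ _ _ h1 h2 h3, vec3_sum _ _ _ _ _ _ _ h1 h2 h3]
    simp only [hDdef]
    constructor <;> ring

  obtain ⟨l1, hl1⟩ : ∃ l, l = D b' C * D C a' * D b' P := ⟨_, rfl⟩
  obtain ⟨l2, hl2⟩ : ∃ l, l = D b' C * D P a * D b C := ⟨_, rfl⟩
  obtain ⟨l3, hl3⟩ : ∃ l, l = - D b P * D C a' * D b' P := ⟨_, rfl⟩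
  obtain ⟨l4, hl4⟩ : ∃ l, l = - D b' C * D P a * D b' P := ⟨_, rfl⟩
  have ea : l1 * D b P + l3 * D b' C = 0 := by rw [hl1, hl3]; ring
  have eb : l1 * D P a + l4 * D C a' = 0 := by rw [hl1, hl4]; ring
  have ea' : l2 * D b' P + l4 * D b C = 0 := by rw [hl2, hl4]; ring
  have eb' : l2 * D P a' + l3 * D C a = 0 := by
    rw [hl2, hl3, hanti a C, hanti a' C, hanti a P, hanti a' P]
    linear_combination -hinv
  let M : Matrix (Fin 4) (Fin n) F := ![w P a b (l1 / g 0), w P a' b' (l2 / g 1),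
    w C a b' (l3 / g 2), w C a' b (l4 / g 3)]
  let s : Fin n → F := fun j => ∑ i, M i j * g i
  have hMrow : ∀ i, M i ∈ Crow := by
    intro i
    fin_cases i
    · exact hw _ _ _ _ hPa hPb hab
    · exact hw _ _ _ _ hPa' hPb' ha'b'
    · exact hw _ _ _ _ hCa hCb' hab'
    · exact hw _ _ _ _ hCa' hCb ha'b
  have g0 := hg 0
  have g1 := hg 1
  have g2 := hg 2
  have g3 := hg 3
  have hs0 : ∀ j, j ≠ P → j ≠ C → s j = 0 := by
    intro j h1 h2
    simp only [s, M, Fin.sum_univ_four, w]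
    by_cases ja : j = a
    · subst ja
      simp [vec3, h1, h2, haa', hab, hab']
      field_simp
      linear_combination ea
    by_cases ja' : j = a'
    · subst ja'
      simp [vec3, h1, h2, Ne.symm haa', ha'b, ha'b']
      field_simp
      linear_combination ea'
    by_cases jb : j = b
    · subst jb
      simp [vec3, h1, h2, Ne.symm hab, Ne.symm ha'b, hbb']
      field_simp
      linear_combination eb
    by_cases jb' : j = b'
    · subst jb'
      simp [vec3, h1, h2, Ne.symm hab', Ne.symm ha'b', Ne.symm hbb']
      field_simp
      linear_combination eb'
    simp [vec3, h1, h2, ja, ja', jb, jb']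
  have hsrow : s ∈ Crow := by
    have : s = ∑ i, g i • M i := by
      ext j
      simp [s, Finset.sum_apply, mul_comm]
    rw [this]
    exact Submodule.sum_mem _ fun i _ => Submodule.smul_mem _ _ (hMrow i)
  rw [hrow] at hsrow
  obtain ⟨sx, sy⟩ := hsrow
  rw [sum_three _ P C a hPC hPa hCa
    (fun j h1 h2 _ => by rw [hs0 j h1 h2, zero_mul])] at sx sy
  rw [hs0 a (Ne.symm hPa) (Ne.symm hCa)] at sx sy
  have hsP : s P = 0 := by
    have h := hD P C hPC
    have : s P * D P C = 0 := by rw [hDdef]; linear_combination y C * sx - x C * sy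
    exact (mul_eq_zero.1 this).resolve_right h
  have hsC : s C = 0 := by
    have h := hD P C hPC
    have : s C * D P C = 0 := by rw [hDdef]; linear_combination x P * sy - y P * sx
    exact (mul_eq_zero.1 this).resolve_right h
  have hs : ∀ j, s j = 0 := by
    intro j
    by_cases h1 : j = P
    · rw [h1, hsP]
    by_cases h2 : j = C
    · rw [h2, hsC]
    exact hs0 j h1 h2
  intro hcor
  have hM0 : M = 0 := by
    apply hcor M ⟨fun j => (hcol _).2 (hs j), hMrow⟩ 0
      ⟨fun j => Ccol.zero_mem, fun i => Crow.zero_mem⟩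
    rintro ⟨i, j⟩ hij
    simp only [patE, Finset.mem_insert, Finset.mem_singleton, Prod.mk.injEq, not_or] at hij
    fin_cases i <;> simp at hij <;> simp [M, w, vec3, hij]
  have h := congrFun (congrFun hM0 0) P
  simp only [M, w, vec3, Matrix.cons_val_zero, if_true, Matrix.zero_apply] at h
  have hl1' : l1 ≠ 0 := by
    rw [hl1]
    exact mul_ne_zero (mul_ne_zero (hD _ _ (Ne.symm hCb')) (hD _ _ hCa')) (hD _ _ (Ne.symm hPb'))
  exact mul_ne_zero (div_ne_zero hl1' g0) (hD _ _ hab) h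


/-- for `n ≥ 8` and a prime power `q < (n-3)²/4 + 2`, no tensor product
of a `[4,3,2]` MDS column code with an `[n,n-2,3]` MDS row code over the field with `q`
elements is maximally recoverable for `T_{4×n}(1,2,0)`: some erasure pattern is
correctable for the topology but not corrected by the code. -/
theorem not_MR_T_4_n_1_2_0_of_small_field (n : ℕ) (hn : 8 ≤ n) (q : ℕ) (hq : IsPrimePow q)
    (hsmall : (q : ℝ) < ((n : ℝ) - 3) ^ 2 / 4 + 2)
    (F : Type) [Field F] [Fintype F] (hF : Fintype.card F = q)
    (Ccol : Submodule F (Fin 4 → F)) (Crow : Submodule F (Fin n → F))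
    (hcol : IsMDSCode F 4 3 Ccol) (hrow : IsMDSCode F n (n - 2) Crow) :
    ∃ E : Finset (Fin 4 × Fin n), CorrectableForTopology 4 n 1 2 E ∧
      ¬ CorrectsPattern (tensorCode Ccol Crow) E := by
  classical
  obtain ⟨hc1, hc2⟩ := hcol
  obtain ⟨hr1, hr2⟩ := hrow
  obtain ⟨gc, hgc⟩ := exists_parity (d := 1) Ccol hc1 rfl
  obtain ⟨hr, hhr⟩ := exists_parity (d := 2) Crow hr1 (by omega)
  have hcol : ∀ v, v ∈ Ccol ↔ ∑ i, v i * gc i 0 = 0 := by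
    intro v; rw [hgc v]; simp
  have hrow : ∀ v, v ∈ Crow ↔ ∑ j, v j * hr j 0 = 0 ∧ ∑ j, v j * hr j 1 = 0 := by
    intro v; rw [hhr v]; simp [Fin.forall_fin_two]
  have hg : ∀ i, gc i 0 ≠ 0 := by
    intro i hi
    have hm : (Pi.single i 1 : Fin 4 → F) ∈ Ccol := by
      rw [hcol]; simp [Pi.single_apply, hi]
    have h := hc2 _ hm (by simp)
    have h' : (Finset.univ.filter fun k => (Pi.single i 1 : Fin 4 → F) k ≠ 0) ⊆ {i} := by
      intro k
      simp only [Finset.mem_filter, Finset.mem_univ, true_and, Finset.mem_singleton]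
      intro hk
      by_contra hne
      exact hk (by simp [hne])
    have h2 := Finset.card_le_card h'
    rw [Finset.card_singleton] at h2
    have h3 : 2 ≤ _ := h
    exact absurd (h3.trans (le_of_eq_of_le (by congr) h2)) (by norm_num)
  have hw2 : ∀ v ∈ Crow, ∀ i j, (∀ k, k ≠ i → k ≠ j → v k = 0) → v = 0 := by
    intro v hv i j hk
    by_contra hv0
    have h := hr2 v hv hv0
    have h' : (Finset.univ.filter fun k => v k ≠ 0) ⊆ {i, j} := by
      intro k
      simp only [Finset.mem_filter, Finset.mem_univ, true_and, Finset.mem_insert,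
        Finset.mem_singleton]
      intro hk'
      by_contra hne
      rw [not_or] at hne
      exact hk' (hk k hne.1 hne.2)
    have h2 := (Finset.card_le_card h').trans Finset.card_le_two
    have h3 := h.trans (le_of_eq_of_le (by congr) h2)
    omega
  obtain ⟨x, hx⟩ : ∃ x : Fin n → F, ∀ j, x j = hr j 0 := ⟨_, fun _ => rfl⟩
  obtain ⟨y, hy⟩ : ∃ y : Fin n → F, ∀ j, y j = hr j 1 := ⟨_, fun _ => rfl⟩
  simp only [← hx, ← hy] at hrow
  have hD : ∀ i j, i ≠ j → x i * y j - x j * y i ≠ 0 := by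
    intro i j hij h0
    obtain ⟨k, hki, hkj⟩ : ∃ k : Fin n, k ≠ i ∧ k ≠ j := by
      have : ({i, j} : Finset (Fin n)).card < (Finset.univ : Finset (Fin n)).card := by
        have := Finset.card_le_two (a := i) (b := j)
        rw [Finset.card_univ, Fintype.card_fin]; omega
      obtain ⟨k, -, hk⟩ := Finset.exists_mem_notMem_of_card_lt_card this
      simp at hk
      exact ⟨k, hk.1, hk.2⟩
    have hv : ∀ r t, r * x i + t * x j = 0 → r * y i + t * y j = 0 → r = 0 ∧ t = 0 := by
      intro r t e1 e2
      have hm : vec3 i j k r t 0 ∈ Crow := by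
        rw [hrow, vec3_sum _ _ _ _ _ _ _ hij (Ne.symm hki) (Ne.symm hkj),
          vec3_sum _ _ _ _ _ _ _ hij (Ne.symm hki) (Ne.symm hkj)]
        simp [e1, e2]
      have h := hw2 _ hm i j (fun l h1 h2 => by simp [vec3, h1, h2])
      have e3 := congrFun h i
      have e4 := congrFun h j
      simp [vec3, Ne.symm hij] at e3 e4
      exact ⟨e3, e4⟩
    obtain ⟨hxj, hxi⟩ := hv (x j) (-x i) (by ring) (by linear_combination -h0)
    obtain ⟨hyj, hyi⟩ := hv (y j) (-y i) (by linear_combination h0) (by ring)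
    have hxi' : x i = 0 := neg_eq_zero.1 hxi
    have hyi' : y i = 0 := neg_eq_zero.1 hyi
    exact one_ne_zero (hv 1 1 (by rw [hxi', hxj]; ring) (by rw [hyi', hyj]; ring)).1
  let P : Fin n := ⟨0, by omega⟩
  let C : Fin n := ⟨1, by omega⟩
  have hPC : P ≠ C := by simp [P, C]
  let S : Finset (Fin n) := (Finset.univ.erase P).erase C
  have hScard : S.card = n - 2 := by
    rw [Finset.card_erase_of_mem (by simp [Ne.symm hPC]), Finset.card_erase_of_mem (by simp),
      Finset.card_univ, Fintype.card_fin]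
    omega
  have hS : ∀ j ∈ S, j ≠ P ∧ j ≠ C := by
    intro j hj
    simp only [S, Finset.mem_erase, Finset.mem_univ, and_true] at hj
    exact ⟨hj.2, hj.1⟩
  let t : Fin n → F := fun j => (x j * y C - x C * y j) / (x j * y P - x P * y j)
  have ht0 : ∀ j ∈ S, t j ≠ 0 := fun j hj =>
    div_ne_zero (hD _ _ (hS j hj).2) (hD _ _ (hS j hj).1)
  have htinj : ∀ i ∈ S, ∀ j ∈ S, t i = t j → i = j := by
    intro i hi j hj h
    by_contra hne
    have e := (div_eq_div_iff (hD _ _ (hS i hi).1) (hD _ _ (hS j hj).1)).1 h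
    have : (x i * y j - x j * y i) * (x P * y C - x C * y P) = 0 := by
      linear_combination -e
    exact mul_ne_zero (hD _ _ hne) (hD _ _ hPC) this
  have hcard : ((Finset.univ : Finset F).erase 0).card < (S.powersetCard 2).card := by
    rw [Finset.card_erase_of_mem (Finset.mem_univ _), Finset.card_univ, hF,
      Finset.card_powersetCard, hScard, Nat.choose_two_right]
    have hq0 : 0 < q := hq.pos
    obtain ⟨m, rfl⟩ : ∃ m, n = m + 3 := ⟨n - 3, by omega⟩
    have h4 : (q : ℝ) * 4 < (m : ℝ) ^ 2 + 8 := by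
      push_cast at hsmall; nlinarith
    have h5 : q * 4 < m ^ 2 + 8 := by exact_mod_cast h4
    have h6 : m + 3 - 2 = m + 1 := by omega
    rw [h6, Nat.add_sub_cancel]
    have : q ≤ (m + 1) * m / 2 := by
      rw [Nat.le_div_iff_mul_le (by norm_num)]
      have : 5 ≤ m := by omega
      nlinarith
    omega
  obtain ⟨A, hA, B, hB, hAB, hprod⟩ := Finset.exists_ne_map_eq_of_card_lt_of_maps_to hcard
    (f := fun A => ∏ j ∈ A, t j) (by
      intro A hA
      have hA' := (Finset.mem_powersetCard.1 (Finset.mem_coe.1 hA)).1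
      simp only [Finset.coe_erase, Set.mem_sdiff, Finset.mem_coe, Finset.mem_univ, true_and,
        Set.mem_singleton_iff]
      exact Finset.prod_ne_zero_iff.2 fun j hj => ht0 j (hA' hj))
  rw [Finset.mem_powersetCard] at hA hB
  obtain ⟨hAS, hA2⟩ := hA
  obtain ⟨hBS, hB2⟩ := hB
  obtain ⟨a, a', haa', rfl⟩ := Finset.card_eq_two.1 hA2
  obtain ⟨b, b', hbb', rfl⟩ := Finset.card_eq_two.1 hB2
  simp only [Finset.prod_pair haa', Finset.prod_pair hbb'] at hprod
  have haS : a ∈ S := hAS (by simp)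
  have ha'S : a' ∈ S := hAS (by simp)
  have hbS : b ∈ S := hBS (by simp)
  have hb'S : b' ∈ S := hBS (by simp)
  have hab : a ≠ b := by
    rintro rfl
    exact hAB (by rw [htinj a' ha'S b' hb'S (mul_left_cancel₀ (ht0 a haS) hprod)])
  have hab' : a ≠ b' := by
    rintro rfl
    rw [mul_comm (t b)] at hprod
    exact hAB (by rw [htinj a' ha'S b hbS (mul_left_cancel₀ (ht0 a haS) hprod), Finset.pair_comm])
  have ha'b : a' ≠ b := by
    rintro rfl
    rw [mul_comm (t a)] at hprod
    exact hAB (by rw [htinj a haS b' hb'S (mul_left_cancel₀ (ht0 a' ha'S) hprod),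
      Finset.pair_comm])
  have ha'b' : a' ≠ b' := by
    rintro rfl
    exact hAB (by rw [htinj a haS b hbS (mul_right_cancel₀ (ht0 a' ha'S) hprod)])
  have hnd : [P, C, a, a', b, b'].Nodup := by
    have h1 := hS a haS
    have h2 := hS a' ha'S
    have h3 := hS b hbS
    have h4 := hS b' hb'S
    simp only [List.nodup_cons, List.mem_cons, List.not_mem_nil, or_false, not_or,
      not_false_eq_true, List.nodup_nil, and_true]
    exact ⟨⟨hPC, h1.1.symm, h2.1.symm, h3.1.symm, h4.1.symm⟩,
      ⟨h1.2.symm, h2.2.symm, h3.2.symm, h4.2.symm⟩, ⟨haa', hab, hab'⟩, ⟨ha'b, ha'b'⟩, hbb'⟩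
  refine ⟨patE P C a a' b b', patE_correctable _ _ _ _ _ _ hnd,
    patE_not_corrected P C a a' b b' hnd Ccol Crow (fun i => gc i 0) x y hg hcol hrow hD ?_⟩
  simp only [t] at hprod
  rw [div_mul_div_comm, div_mul_div_comm, div_eq_div_iff
    (mul_ne_zero (hD _ _ (hS a haS).1) (hD _ _ (hS a' ha'S).1))
    (mul_ne_zero (hD _ _ (hS b hbS).1) (hD _ _ (hS b' hb'S).1))] at hprod
  exact hprod
end
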